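/- arXiv:1409.1109 — 10 statements merged into one kernel-verified Lean document; each statement's English description precedes it below -/
import Mathlib

section
/- Let N ≥ 1. Let Q : ℝ^N → ℝ be a smooth (C^∞) function with Q ≥ 0, Q(x) = 0 only for x = 0, Q convex on the open unit ball B_1, and Q constant on ℝ^N \ B_2. Let φ : ℝ^N → ℝ be smooth (C^∞) and let x̄ ∈ ℝ^N be a point with Dφ(x̄) ≠ 0. For η ∈ ℝ set φ^η(x) := φ(x) + η Q(x − x̄). Then there exists η₀ > 0 such that for Lebesgue-almost every η ∈ (0, η₀), the level set {x ∈ ℝ^N : φ^η(x) = φ(x̄)} is noncritical, i.e. Dφ^η(x) ≠ 0 for every x with φ^η(x) = φ(x̄). -/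
open MeasureTheory Metric Set

open Filter Topology Module

/-- A locally null image in a second countable space is null. -/
lemma measure_image_null_of_locally_null {X Y : Type*} [TopologicalSpace X]
    [SecondCountableTopology X] [MeasurableSpace Y] {μ : Measure Y} {f : X → Y} {s : Set X}
    (h : ∀ x ∈ s, ∃ t ∈ 𝓝[s] x, μ (f '' t) = 0) : μ (f '' s) = 0 := by
  choose! t ht hμ using h
  obtain ⟨u, hus, huc, hu⟩ := TopologicalSpace.countable_cover_nhdsWithin ht
  refine measure_mono_null (image_mono hu) ?_
  rw [image_iUnion₂]
  exact (measure_biUnion_null_iff huc).2 fun x hx => hμ x (hus hx)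

/-- If the derivatives of `f` of orders `1, …, n` vanish at `x`, then `f y - f x` is
`O(‖y - x‖ ^ (n + 1))`, locally uniformly in `x`. -/
lemma ContDiffAt.exists_norm_sub_le_of_iteratedFDeriv_eq_zero {E : Type}
    [NormedAddCommGroup E] [NormedSpace ℝ E] (n : ℕ) :
    ∀ {F : Type} [NormedAddCommGroup F] [NormedSpace ℝ F] {f : E → F} {a : E},
      ContDiffAt ℝ (n + 1 : ℕ) f a →
      ∃ C : NNReal, ∃ t ∈ 𝓝 a, ∀ x ∈ t, ∀ y ∈ t,
        (∀ k < n, iteratedFDeriv ℝ (k + 1) f x = 0) → ‖f y - f x‖ ≤ C * ‖y - x‖ ^ (n + 1) := by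
  induction n with
  | zero =>
    intro F _ _ f a hf
    obtain ⟨C, t, ht, h⟩ := (hf.of_le (by simp) : ContDiffAt ℝ 1 f a).exists_lipschitzOnWith
    exact ⟨C, t, ht, fun x hx y hy _ => by simpa using h.norm_sub_le hy hx⟩
  | succ n ih =>
    intro F _ _ f a hf
    have hdf : ContDiffAt ℝ (n + 1 : ℕ) (fderiv ℝ f) a :=
      hf.fderiv_right (by norm_cast)
    obtain ⟨C, t, ht, h⟩ := ih hdf
    have hd : ∀ᶠ x in 𝓝 a, DifferentiableAt ℝ f x :=
      (hf.eventually (by simp)).mono fun x hx => hx.differentiableAt (by simp)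
    obtain ⟨r, hr, hrt⟩ := Metric.mem_nhds_iff.1 (inter_mem ht hd)
    refine ⟨C, ball a r, ball_mem_nhds a hr, fun x hx y hy hflat => ?_⟩
    have hseg : segment ℝ x y ⊆ ball a r := (convex_ball a r).segment_subset hx hy
    have hzero : fderiv ℝ f x = 0 := by
      have := hflat 0 (by simp)
      rw [← norm_eq_zero, ← norm_iteratedFDeriv_fderiv] at this
      simpa using this
    have hbound : ∀ z ∈ segment ℝ x y, ‖fderiv ℝ f z‖ ≤ C * ‖y - x‖ ^ (n + 1) := by
      intro z hz
      have h1 := h x (hrt hx).1 z (hrt (hseg hz)).1 fun k hk => by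
        rw [← norm_eq_zero, norm_iteratedFDeriv_fderiv, norm_eq_zero]
        exact hflat (k + 1) (by lia)
      rw [hzero, sub_zero] at h1
      refine h1.trans ?_
      gcongr
      exact norm_sub_le_of_mem_segment hz
    refine ((convex_segment x y).norm_image_sub_le_of_norm_fderiv_le
      (fun z hz => (hrt (hseg hz)).2) hbound (left_mem_segment ℝ x y)
      (right_mem_segment ℝ x y)).trans_eq ?_
    ring

/-- The image of the set of points where the first `finrank ℝ E` derivatives vanish is null. -/
lemma volume_image_flat_eq_zero {E : Type} [NormedAddCommGroup E] [NormedSpace ℝ E]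
    [FiniteDimensional ℝ E] {f : E → ℝ} {U : Set E}
    (hf : ∀ x ∈ U, ContDiffAt ℝ (finrank ℝ E + 1 : ℕ) f x) :
    volume (f '' {x ∈ U | ∀ k < finrank ℝ E, iteratedFDeriv ℝ (k + 1) f x = 0}) = 0 := by
  set N := finrank ℝ E with hN
  set s := {x ∈ U | ∀ k < N, iteratedFDeriv ℝ (k + 1) f x = 0}
  have := FiniteDimensional.proper ℝ E
  have hdim : dimH (f '' s) ≤ dimH s / ((N + 1 : ℕ) : NNReal) := by
    refine dimH_image_le_of_locally_holder_on (by positivity) fun a ha => ?_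
    obtain ⟨C, t, ht, h⟩ := (hf a ha.1).exists_norm_sub_le_of_iteratedFDeriv_eq_zero
    refine ⟨C, s ∩ t, inter_mem_nhdsWithin s ht, fun x hx y hy => ?_⟩
    rw [edist_dist, edist_dist, dist_comm, dist_comm x, dist_eq_norm, dist_eq_norm,
      ENNReal.ofReal_rpow_of_nonneg (by positivity) (by positivity),
      ← ENNReal.ofReal_coe_nnreal, ← ENNReal.ofReal_mul (by positivity)]
    refine ENNReal.ofReal_le_ofReal ?_
    have := h x hx.2 y hy.2 hx.1.2
    rwa [NNReal.coe_natCast, Real.rpow_natCast]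
  have hlt : dimH (f '' s) < (1 : NNReal) := by
    refine hdim.trans_lt ?_
    refine (ENNReal.div_le_div_right ((dimH_mono (subset_univ s)).trans_eq
      (Real.dimH_univ_eq_finrank E)) _).trans_lt ?_
    rw [← hN]
    refine (ENNReal.div_lt_iff (by simp) (by simp)).2 ?_
    norm_cast
    simp
  have := hausdorffMeasure_of_dimH_lt hlt
  rwa [NNReal.coe_one, hausdorffMeasure_real] at this

/-- The Sard property in dimension `N` and smoothness `C^k`. -/
def SardProperty (N k : ℕ) : Prop :=
  ∀ (E : Type) [NormedAddCommGroup E] [NormedSpace ℝ E] [FiniteDimensional ℝ E],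
    finrank ℝ E = N → ∀ (f : E → ℝ) (U : Set E), (∀ x ∈ U, ContDiffAt ℝ k f x) →
      volume (f '' {x ∈ U | fderiv ℝ f x = 0}) = 0

section

variable {E : Type} [NormedAddCommGroup E] [NormedSpace ℝ E] [FiniteDimensional ℝ E] {N k : ℕ}

/-- Near a regular point of `w`, the critical points of `f` on a level set of `w` have null image,
provided that the Sard property holds in one dimension less. -/
lemma SardProperty.exists_nhds_volume_image_eq_zero (H : SardProperty N k) (hk : k ≠ 0)
    (hE : finrank ℝ E = N + 1) {f w : E → ℝ} {a : E} (hf : ContDiffAt ℝ k f a)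
    (hw : ContDiffAt ℝ k w a) (hwa : w a = 0) (hdw : fderiv ℝ w a ≠ 0) :
    ∃ t ∈ 𝓝 a, volume (f '' (t ∩ {x | w x = 0 ∧ fderiv ℝ f x = 0})) = 0 := by
  have hk' : (k : WithTop ℕ∞) ≠ 0 := by exact_mod_cast hk
  have hs : HasStrictFDerivAt w (fderiv ℝ w a) a := hw.hasStrictFDerivAt hk'
  have hrange : (fderiv ℝ w a).range = ⊤ :=
    LinearMap.range_eq_top.2 (LinearMap.surjective (by exact_mod_cast hdw))
  let K := (fderiv ℝ w a).ker
  have hKrank : finrank ℝ K = N := by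
    have := LinearMap.finrank_range_add_finrank_ker (fderiv ℝ w a : E →ₗ[ℝ] ℝ)
    rw [hE, hrange, finrank_top, finrank_self, add_comm] at this
    exact Nat.add_right_cancel this
  let φ := HasStrictFDerivAt.implicitFunctionDataOfComplemented w (fderiv ℝ w a) hs hrange
    (fderiv ℝ w a).ker_closedComplemented_of_finiteDimensional_range
  have hφpt : φ.pt = a := rfl
  have hφl : φ.leftFun = w := rfl
  have hr : ContDiff ℝ k φ.rightFun :=
    (ContinuousLinearMap.contDiff _).comp (contDiff_id.sub contDiff_const)
  let ψ : K → E := φ.implicitFunction 0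
  set b : K := φ.rightFun a
  have hψ : ContDiffAt ℝ k ψ b := by
    have := φ.contDiffAt_implicitFunction (n := k) hw hr.contDiffAt hk'
    have hpt : φ.prodFun φ.pt = (0, b) := by
      rw [φ.prodFun_apply, hφpt, hφl, hwa]
    rw [hpt] at this
    exact this.comp b (contDiffAt_const.prodMk contDiffAt_id)
  have hψb : ψ b = a := by
    have := φ.implicitFunction_apply_image.self_of_nhds
    rwa [hφpt, hφl, hwa] at this
  have hψev : ∀ᶠ z in 𝓝 b, ContDiffAt ℝ k ψ z := hψ.eventually (by simp)
  have hfψ : ∀ᶠ z in 𝓝 b, ContDiffAt ℝ k f (ψ z) := by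
    have : ∀ᶠ x in 𝓝 (ψ b), ContDiffAt ℝ k f x := by
      rw [hψb]; exact hf.eventually (by simp)
    exact hψ.continuousAt.eventually this
  set Z : Set K := {z | ContDiffAt ℝ k ψ z ∧ ContDiffAt ℝ k f (ψ z)}
  have hZ : Z ∈ 𝓝 b := hψev.and hfψ
  refine ⟨φ.rightFun ⁻¹' Z ∩ {x | φ.implicitFunction (φ.leftFun x) (φ.rightFun x) = x},
    inter_mem (hr.continuous.continuousAt.preimage_mem_nhds hZ) φ.implicitFunction_apply_image,
    measure_mono_null ?_ (H K hKrank (f ∘ ψ) Z fun z hz => hz.2.comp z hz.1)⟩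
  rintro _ ⟨x, ⟨⟨hxZ, hx⟩, hwx, hfx⟩, rfl⟩
  have hψx : ψ (φ.rightFun x) = x := by
    change φ.implicitFunction (w x) (φ.rightFun x) = x at hx
    rwa [hwx] at hx
  refine ⟨φ.rightFun x, ⟨hxZ, ?_⟩, congrArg f hψx⟩
  rw [fderiv_comp _ (hxZ.2.differentiableAt hk') (hxZ.1.differentiableAt hk'), hψx, hfx,
    ContinuousLinearMap.zero_comp]

/-- The critical points of `f` at which `G` vanishes, but some derivative of `G` of order `1, …, n`
does not, have null image, provided that the Sard property holds in one dimension less. -/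
lemma SardProperty.volume_image_not_flat_eq_zero (H : SardProperty N k) (hk : k ≠ 0)
    (hE : finrank ℝ E = N + 1) {f : E → ℝ} {U : Set E} (hf : ∀ x ∈ U, ContDiffAt ℝ k f x)
    (n : ℕ) : ∀ {F : Type} [NormedAddCommGroup F] [NormedSpace ℝ F] {G : E → F},
      (∀ x ∈ U, ContDiffAt ℝ (k + n : ℕ) G x) →
      volume (f '' {x ∈ U | fderiv ℝ f x = 0 ∧ G x = 0 ∧
        ¬ ∀ i < n, iteratedFDeriv ℝ (i + 1) G x = 0}) = 0 := by
  have := FiniteDimensional.proper ℝ E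
  induction n with
  | zero => simp
  | succ n ih =>
    intro F _ _ G hG
    have hdG : ∀ x ∈ U, ContDiffAt ℝ (k + n : ℕ) (fderiv ℝ G) x := fun x hx =>
      (hG x hx).fderiv_right (by norm_cast)
    have hregular : volume (f '' {x ∈ U | fderiv ℝ f x = 0 ∧ G x = 0 ∧ fderiv ℝ G x ≠ 0}) = 0 := by
      refine measure_image_null_of_locally_null fun a ha => ?_
      obtain ⟨haU, -, hGa, hdGa⟩ := ha
      obtain ⟨v, hv⟩ : ∃ v, fderiv ℝ G a v ≠ 0 := by
        by_contra! h
        exact hdGa (ContinuousLinearMap.ext h)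
      obtain ⟨l, -, hl⟩ := exists_dual_vector ℝ _ (norm_ne_zero_iff.2 hv)
      have hGk : ContDiffAt ℝ k G a := (hG a haU).of_le (by norm_cast; lia)
      have hdw : fderiv ℝ (l ∘ G) a ≠ 0 := by
        rw [fderiv_comp a l.differentiableAt (hGk.differentiableAt (by exact_mod_cast hk))]
        intro h
        have := congrArg (fun L => L v) h
        simp [hl, hv] at this
      obtain ⟨t, ht, hnull⟩ := H.exists_nhds_volume_image_eq_zero hk hE (hf a haU)
        (l.contDiff.contDiffAt.comp a hGk) (by simp [hGa]) hdw
      refine ⟨_, inter_mem_nhdsWithin _ ht, measure_mono_null (image_mono ?_) hnull⟩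
      exact fun x hx => ⟨hx.2, by simp [hx.1.2.2.1], hx.1.2.1⟩
    refine measure_mono_null ?_ (measure_union_null hregular (ih hdG))
    rw [← image_union]
    refine image_mono fun x ⟨hxU, hfx, hGx, hx⟩ => ?_
    by_cases hd : fderiv ℝ G x = 0
    · refine .inr ⟨hxU, hfx, hd, fun h => hx fun i hi => ?_⟩
      rw [← norm_eq_zero, ← norm_iteratedFDeriv_fderiv, norm_eq_zero]
      cases i with
      | zero => rw [← norm_eq_zero]; simp [hd]
      | succ i => exact h i (by lia)
    · exact .inl ⟨hxU, hfx, hGx, hd⟩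

end

lemma sardProperty (N : ℕ) : SardProperty N ((N + 1) ^ 2) := by
  induction N with
  | zero =>
    intro E _ _ _ hE f U _
    have := finrank_zero_iff.1 hE
    exact ((subsingleton_of_subsingleton).image f).measure_zero _
  | succ N ih =>
    intro E _ _ _ hE f U hf
    have hle : (N + 1) ^ 2 + N + 2 ≤ (N + 1 + 1) ^ 2 := by nlinarith
    have hflat := volume_image_flat_eq_zero (f := f) (U := U) fun x hx =>
      (hf x hx).of_le (by rw [hE]; norm_cast; nlinarith)
    have hnot := ih.volume_image_not_flat_eq_zero (by positivity) hE (f := f) (U := U)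
      (fun x hx => (hf x hx).of_le (by norm_cast; lia)) N (G := fderiv ℝ f) fun x hx =>
        (hf x hx).fderiv_right (by norm_cast; lia)
    refine measure_mono_null ?_ (measure_union_null hflat hnot)
    rw [← image_union]
    refine image_mono fun x ⟨hxU, hx⟩ => ?_
    by_cases h : ∀ i < N, iteratedFDeriv ℝ (i + 1) (fderiv ℝ f) x = 0
    · refine .inl ⟨hxU, fun i hi => ?_⟩
      rw [← norm_eq_zero, ← norm_iteratedFDeriv_fderiv, norm_eq_zero]
      cases i with
      | zero => rw [← norm_eq_zero]; simp [hx]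
      | succ i => exact h i (by lia)
    · exact .inr ⟨hxU, hx, hx, h⟩

/-- **Sard's theorem** for smooth real-valued functions on a finite-dimensional space: the set of
critical values is null. -/
theorem volume_image_critical_eq_zero {E : Type} [NormedAddCommGroup E] [NormedSpace ℝ E]
    [FiniteDimensional ℝ E] {f : E → ℝ} {U : Set E}
    (hf : ∀ x ∈ U, ContDiffAt ℝ (⊤ : ℕ∞) f x) :
    volume (f '' {x ∈ U | fderiv ℝ f x = 0}) = 0 :=
  sardProperty (finrank ℝ E) E rfl f U fun x hx => (hf x hx).of_le (by exact_mod_cast le_top)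

/-- **Sard-type lemma for perturbed level sets.** Let `Q ≥ 0` be smooth,
vanishing only at the origin, convex on the unit ball and constant outside `B_2`.  Let `φ`
be smooth with `Dφ(x₀) ≠ 0`.  Then there is `η₀ > 0` such that for a.e. `η ∈ (0, η₀)` the
level set `{φ + η Q(· − x₀) = φ(x₀)}` is noncritical. -/
theorem stmt0 (N : ℕ) (hN : 1 ≤ N)
    (Q : EuclideanSpace ℝ (Fin N) → ℝ)
    (hQsmooth : ContDiff ℝ (⊤ : ℕ∞) Q)
    (hQnonneg : ∀ x, 0 ≤ Q x)
    (hQ0 : Q 0 = 0)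
    (hQzero : ∀ x, Q x = 0 → x = 0)
    (hQconvex : ConvexOn ℝ (ball (0 : EuclideanSpace ℝ (Fin N)) 1) Q)
    (hQconst : ∃ c : ℝ, ∀ x : EuclideanSpace ℝ (Fin N), 2 ≤ ‖x‖ → Q x = c)
    (φ : EuclideanSpace ℝ (Fin N) → ℝ)
    (hφsmooth : ContDiff ℝ (⊤ : ℕ∞) φ)
    (x₀ : EuclideanSpace ℝ (Fin N))
    (hgrad : fderiv ℝ φ x₀ ≠ 0) :
    ∃ η₀ > (0:ℝ), ∀ᵐ η ∂(volume : Measure ℝ), η ∈ Set.Ioo (0:ℝ) η₀ →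
      ∀ x : EuclideanSpace ℝ (Fin N),
        φ x + η * Q (x - x₀) = φ x₀ →
          fderiv ℝ (fun y => φ y + η * Q (y - x₀)) x ≠ 0 := by
  refine ⟨1, one_pos, ?_⟩
  let g : EuclideanSpace ℝ (Fin N) → ℝ := fun x => (φ x₀ - φ x) / Q (x - x₀)
  have hQd : ContDiff ℝ (⊤ : ℕ∞) fun x => Q (x - x₀) :=
    hQsmooth.comp (contDiff_id.sub contDiff_const)
  have hne : ∀ x, x ≠ x₀ → Q (x - x₀) ≠ 0 := fun x hx h => hx (sub_eq_zero.1 (hQzero _ h))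
  have hg : ∀ x ∈ ({x₀}ᶜ : Set (EuclideanSpace ℝ (Fin N))), ContDiffAt ℝ (⊤ : ℕ∞) g x :=
    fun x hx => (contDiff_const.sub hφsmooth).contDiffAt.div hQd.contDiffAt (hne x hx)
  have hnull := volume_image_critical_eq_zero hg
  filter_upwards [compl_mem_ae_iff.2 hnull] with η hη _ x hx hcrit
  have hφ' := (hφsmooth.differentiable (by simp) x).hasFDerivAt
  have hQ' := (hQd.differentiable (by simp) x).hasFDerivAt
  have hsum : fderiv ℝ φ x + η • fderiv ℝ (fun x => Q (x - x₀)) x = 0 :=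
    (hφ'.add (hQ'.const_mul η)).fderiv.symm.trans hcrit
  by_cases hxx : x = x₀
  · subst hxx
    have hmin : IsLocalMin (fun y => Q (y - x)) x :=
      Eventually.of_forall fun y => by simpa [hQ0] using hQnonneg (y - x)
    rw [hmin.fderiv_eq_zero, smul_zero, add_zero] at hsum
    exact hgrad hsum
  · have hgx : g x = η := by
      rw [div_eq_iff (hne x hxx)]
      linarith
    refine hη ⟨x, ⟨hxx, ?_⟩, hgx⟩
    have hg' := ((hg x hxx).differentiableAt (by simp)).hasFDerivAt
    have hloc : (fun y => g y * Q (y - x₀)) =ᶠ[𝓝 x] fun y => φ x₀ - φ y := by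
      filter_upwards [isOpen_ne.mem_nhds hxx] with y hy
      exact div_mul_cancel₀ _ (hne y hy)
    have heq := ((hg'.mul hQ').congr_of_eventuallyEq hloc.symm).unique (hφ'.const_sub (φ x₀))
    rw [hgx, ← eq_neg_of_add_eq_zero_right hsum, add_eq_left] at heq
    exact (smul_eq_zero.1 heq).resolve_left (hne x hxx)
end

section
/- Let N ≥ 1 and let Φ be a functional defined on locally integrable functions ℝ^N → ℝ with values in [0, +∞] such that: Φ is convex; Φ is translation invariant, i.e. Φ(u(· − y)) = Φ(u) for every locally integrable u and every y ∈ ℝ^N; and Φ is sequentially lower semicontinuous with respect to L¹_loc convergence. Let ρ : ℝ^N → [0, ∞) be a nonnegative, compactly supported, integrable function with ∫ρ = 1, and for ε > 0 set ρ_ε(x) := ε^{−N} ρ(x/ε). Then for every locally integrable u : ℝ^N → ℝ and every ε > 0 one has Φ(ρ_ε ∗ u) ≤ Φ(u); moreover, Φ(ρ_ε ∗ u) → Φ(u) as ε → 0⁺. -/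
open MeasureTheory Filter Set
open scoped ENNReal

/-- An average of a family indexed by the values of a simple function is a finite sum. -/
lemma MeasureTheory.SimpleFunc.integral_comp_eq_sum {Ω : Type*} [MeasurableSpace Ω] {μ : Measure Ω}
    [IsFiniteMeasure μ] {α : Type*} (s : SimpleFunc Ω α) (g : α → ℝ) :
    ∫ ω, g (s ω) ∂μ = ∑ a ∈ s.range, μ.real (s ⁻¹' {a}) * g a := by
  classical
  have h (ω : Ω) : g (s ω) = ∑ a ∈ s.range, (s ⁻¹' {a}).indicator (fun _ => g a) ω := by
    simp only [indicator_apply, mem_preimage, mem_singleton_iff]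
    rw [Finset.sum_ite_eq, if_pos (s.mem_range_self ω)]
  simp_rw [h]
  rw [integral_finsetSum _ fun a _ =>
    (integrable_const (g a)).indicator (s.measurableSet_fiber a)]
  simp [integral_indicator_const, s.measurableSet_fiber]

section Translates

variable {E : Type*} [NormedAddCommGroup E] {u : E → ℝ}

/-- On a ball, translates by bounded vectors only see the values on a larger ball. -/
lemma indicator_ball_translate {R M : ℝ} {x y : E} (hx : x ∈ Metric.ball (0 : E) R)
    (hy : ‖y‖ ≤ M) : (Metric.ball (0 : E) (R + M)).indicator u (x - y) = u (x - y) := by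
  refine indicator_of_mem ?_ _
  rw [mem_ball_zero_iff] at hx ⊢
  linarith [norm_sub_le x y]

variable [MeasurableSpace E] {ν : Measure E}

lemma locallyIntegrable_of_integrableOn_ball (hu : ∀ R, IntegrableOn u (Metric.ball 0 R) ν) :
    LocallyIntegrable u ν := fun x =>
  ⟨_, Metric.isOpen_ball.mem_nhds (by simp : x ∈ Metric.ball 0 (‖x‖ + 1)), hu _⟩

section Functional

variable {Φ : (E → ℝ) → ℝ≥0∞}

lemma convex_sublevel_of_convex_functional
    (hconv : ∀ u v : E → ℝ, LocallyIntegrable u ν → LocallyIntegrable v ν →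
      ∀ t : ℝ, t ∈ Set.Icc (0:ℝ) 1 →
        Φ (fun x => t * u x + (1 - t) * v x) ≤
          ENNReal.ofReal t * Φ u + ENNReal.ofReal (1 - t) * Φ v) (c : ℝ≥0∞) :
    Convex ℝ {f : E → ℝ | LocallyIntegrable f ν ∧ Φ f ≤ c} := by
  rintro f ⟨hf, hfc⟩ g ⟨hg, hgc⟩ a b ha hb hab
  refine ⟨(hf.smul a).add (hg.smul b), ?_⟩
  obtain rfl : b = 1 - a := by linarith
  calc Φ (a • f + (1 - a) • g)
      ≤ ENNReal.ofReal a * Φ f + ENNReal.ofReal (1 - a) * Φ g :=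
        hconv f g hf hg a ⟨ha, by linarith⟩
    _ ≤ ENNReal.ofReal a * c + ENNReal.ofReal (1 - a) * c := by gcongr
    _ = c := by
        rw [← add_mul, ← ENNReal.ofReal_add ha hb, hab, ENNReal.ofReal_one, one_mul]

lemma functional_congr_ae
    (hlsc : ∀ (un : ℕ → E → ℝ) (u : E → ℝ),
      (∀ n, LocallyIntegrable (un n) ν) → LocallyIntegrable u ν →
      (∀ R > (0:ℝ), Tendsto
        (fun n => ∫ x in Metric.ball (0 : E) R, |un n x - u x| ∂ν) atTop (nhds 0)) →
      Φ u ≤ liminf (fun n => Φ (un n)) atTop)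
    {v : E → ℝ} (hu : LocallyIntegrable u ν) (huv : u =ᵐ[ν] v) : Φ u = Φ v := by
  have key {f g : E → ℝ} (hf : LocallyIntegrable f ν) (hfg : f =ᵐ[ν] g) : Φ f ≤ Φ g := by
    refine (hlsc (fun _ => g) f (fun _ => hf.congr hfg) hf fun R _ => ?_).trans_eq
      (liminf_const _)
    refine tendsto_const_nhds.congr fun _ => (integral_eq_zero_of_ae ?_).symm
    filter_upwards [ae_restrict_of_ae hfg] with x hx
    simp [hx]
  exact le_antisymm (key hu huv) (key (hu.congr huv) huv.symm)

end Functional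

variable [NormedSpace ℝ E] [FiniteDimensional ℝ E]

lemma MeasureTheory.LocallyIntegrable.integrableOn_ball (hu : LocallyIntegrable u ν) (R : ℝ) :
    IntegrableOn u (Metric.ball 0 R) ν :=
  (hu.integrableOn_isCompact (isCompact_closedBall 0 R)).mono_set Metric.ball_subset_closedBall

variable [BorelSpace E]

lemma MeasureTheory.LocallyIntegrable.integrable_indicator_ball
    (hu : LocallyIntegrable u ν) (R : ℝ) :
    Integrable ((Metric.ball (0 : E) R).indicator u) ν :=
  (hu.integrableOn_ball R).integrable_indicator measurableSet_ball

variable [ν.IsAddHaarMeasure]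

/-- Translations act continuously on `L¹`. -/
lemma MeasureTheory.Integrable.tendsto_integral_abs_translate_sub {f : E → ℝ}
    (hf : Integrable f ν) (y₀ : E) :
    Tendsto (fun y => ∫ x, |f (x - y) - f (x - y₀)| ∂ν) (nhds y₀) (nhds 0) := by
  have hf' : MemLp f 1 ν := memLp_one_iff_integrable.2 hf
  have : Fact ((1 : ℝ≥0∞) ≠ ∞) := ⟨ENNReal.one_ne_top⟩
  let T : E → Lp ℝ 1 ν := fun y => DomAddAct.mk (-y) +ᵥ hf'.toLp f
  have hT : Continuous T := by
    have h : Continuous fun y : E => DomAddAct.mk (-y) :=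
      DomAddAct.mkHomeomorph.continuous.comp continuous_neg
    exact h.vadd continuous_const
  have hTy (y : E) : T y =ᵐ[ν] fun x => f (x - y) := by
    simp only [T, DomAddAct.mk_vadd_toLp]
    refine (MemLp.coeFn_toLp _).trans (Eventually.of_forall fun x => ?_)
    simp [sub_eq_neg_add]
  have hnorm (y : E) : ‖T y - T y₀‖ = ∫ x, |f (x - y) - f (x - y₀)| ∂ν := by
    rw [L1.norm_eq_integral_norm]
    refine integral_congr_ae ?_
    filter_upwards [Lp.coeFn_sub (T y) (T y₀), hTy y, hTy y₀] with x h1 h2 h3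
    rw [h1, Pi.sub_apply, h2, h3, Real.norm_eq_abs]
  simp_rw [← hnorm]
  exact tendsto_iff_norm_sub_tendsto_zero.1 hT.continuousAt

lemma MeasureTheory.LocallyIntegrable.integrableOn_ball_translate
    (hu : LocallyIntegrable u ν) (R : ℝ) (y : E) :
    IntegrableOn (fun x => u (x - y)) (Metric.ball 0 R) ν := by
  have h := ((hu.integrable_indicator_ball (R + ‖y‖)).comp_sub_right y).integrableOn
    (s := Metric.ball 0 R)
  exact h.congr_fun (fun x hx => indicator_ball_translate hx le_rfl) measurableSet_ball

lemma MeasureTheory.LocallyIntegrable.translate (hu : LocallyIntegrable u ν) (y : E) :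
    LocallyIntegrable (fun x => u (x - y)) ν :=
  locallyIntegrable_of_integrableOn_ball fun R => hu.integrableOn_ball_translate R y

lemma MeasureTheory.LocallyIntegrable.setIntegral_abs_translate_le
    (hu : LocallyIntegrable u ν) (R : ℝ) {M : ℝ} {y : E} (hy : ‖y‖ ≤ M) :
    ∫ x in Metric.ball 0 R, |u (x - y)| ∂ν ≤
      ∫ x, |(Metric.ball (0 : E) (R + M)).indicator u x| ∂ν := by
  have hint := hu.integrable_indicator_ball (R + M)
  calc ∫ x in Metric.ball 0 R, |u (x - y)| ∂ν
      = ∫ x in Metric.ball 0 R, |(Metric.ball (0 : E) (R + M)).indicator u (x - y)| ∂ν :=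
        setIntegral_congr_fun measurableSet_ball fun x hx => by
          simp only [indicator_ball_translate hx hy]
    _ ≤ ∫ x, |(Metric.ball (0 : E) (R + M)).indicator u (x - y)| ∂ν :=
        setIntegral_le_integral (hint.comp_sub_right y).abs
          (Eventually.of_forall fun _ => abs_nonneg _)
    _ = _ := integral_sub_right_eq_self
        (fun x => |(Metric.ball (0 : E) (R + M)).indicator u x|) y

lemma MeasureTheory.LocallyIntegrable.tendsto_setIntegral_abs_translate_sub
    (hu : LocallyIntegrable u ν) (R : ℝ) (y₀ : E) :
    Tendsto (fun y => ∫ x in Metric.ball 0 R, |u (x - y) - u (x - y₀)| ∂ν)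
      (nhds y₀) (nhds 0) := by
  set M := ‖y₀‖ + 1
  have hint := hu.integrable_indicator_ball (R + M)
  refine tendsto_of_tendsto_of_tendsto_of_le_of_le' tendsto_const_nhds
    (hint.tendsto_integral_abs_translate_sub y₀)
    (Eventually.of_forall fun y => integral_nonneg fun _ => abs_nonneg _) ?_
  have hev : ∀ᶠ y in nhds y₀, ‖y‖ < M :=
    continuous_norm.continuousAt.eventually_lt_const (by simp [M])
  filter_upwards [hev] with y hy
  rw [setIntegral_congr_fun (g := fun x => |(Metric.ball (0 : E) (R + M)).indicator u (x - y) -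
    (Metric.ball (0 : E) (R + M)).indicator u (x - y₀)|) measurableSet_ball fun x hx => by
      simp only [indicator_ball_translate hx hy.le,
        indicator_ball_translate (y := y₀) (M := M) hx (by simp [M])]]
  exact setIntegral_le_integral ((hint.comp_sub_right y).sub (hint.comp_sub_right y₀)).abs
    (Eventually.of_forall fun _ => abs_nonneg _)

variable {Ω : Type*} [MeasurableSpace Ω] {μ : Measure Ω} [IsFiniteMeasure μ]

lemma integrable_prod_translate (hu : LocallyIntegrable u ν) (hum : Measurable u)
    {φ : Ω → E} (hφ : Measurable φ) {M : ℝ} (hM : ∀ᵐ ω ∂μ, ‖φ ω‖ ≤ M) (R : ℝ) :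
    Integrable (fun p : E × Ω => u (p.1 - φ p.2)) ((ν.restrict (Metric.ball 0 R)).prod μ) := by
  have hm : Measurable fun p : E × Ω => u (p.1 - φ p.2) :=
    hum.comp (measurable_fst.sub (hφ.comp measurable_snd))
  refine (integrable_prod_iff' hm.aestronglyMeasurable).2
    ⟨Eventually.of_forall fun ω => hu.integrableOn_ball_translate R (φ ω), ?_⟩
  refine (integrable_const (∫ x, |(Metric.ball (0 : E) (R + M)).indicator u x| ∂ν)).mono'
    hm.norm.stronglyMeasurable.integral_prod_left'.aestronglyMeasurable ?_
  filter_upwards [hM] with ω hω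
  rw [Real.norm_of_nonneg (integral_nonneg fun _ => norm_nonneg _)]
  exact hu.setIntegral_abs_translate_le R hω

/-- Averages of translates of a locally integrable function are locally integrable. -/
lemma locallyIntegrable_integral_translate (hu : LocallyIntegrable u ν) (hum : Measurable u)
    {φ : Ω → E} (hφ : Measurable φ) {M : ℝ} (hM : ∀ᵐ ω ∂μ, ‖φ ω‖ ≤ M) :
    LocallyIntegrable (fun x => ∫ ω, u (x - φ ω) ∂μ) ν :=
  locallyIntegrable_of_integrableOn_ball fun R =>
    (integrable_prod_translate hu hum hφ hM R).integral_prod_left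

/-- Averages of translates depend continuously, in `L¹_loc`, on the translation vectors. -/
lemma tendsto_setIntegral_abs_integral_translate_sub
    (hu : LocallyIntegrable u ν) (hum : Measurable u)
    {ι : Type*} {l : Filter ι} [l.IsCountablyGenerated] {φ : ι → Ω → E} {ψ : Ω → E}
    (hφ : ∀ i, Measurable (φ i)) (hψ : Measurable ψ) {M : ℝ}
    (hφM : ∀ᶠ i in l, ∀ᵐ ω ∂μ, ‖φ i ω‖ ≤ M) (hψM : ∀ᵐ ω ∂μ, ‖ψ ω‖ ≤ M)
    (hlim : ∀ᵐ ω ∂μ, Tendsto (fun i => φ i ω) l (nhds (ψ ω))) (R : ℝ) :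
    Tendsto (fun i => ∫ x in Metric.ball 0 R,
      |∫ ω, u (x - φ i ω) ∂μ - ∫ ω, u (x - ψ ω) ∂μ| ∂ν) l (nhds 0) := by
  set C := ∫ x, |(Metric.ball (0 : E) (R + M)).indicator u x| ∂ν
  have hmeas (i : ι) : Measurable fun p : E × Ω => |u (p.1 - φ i p.2) - u (p.1 - ψ p.2)| :=
    ((hum.comp (measurable_fst.sub ((hφ i).comp measurable_snd))).sub
      (hum.comp (measurable_fst.sub (hψ.comp measurable_snd)))).norm
  have hdom : Tendsto (fun i => ∫ ω, ∫ x in Metric.ball 0 R,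
      |u (x - φ i ω) - u (x - ψ ω)| ∂ν ∂μ) l (nhds (∫ _, (0 : ℝ) ∂μ)) := by
    refine tendsto_integral_filter_of_dominated_convergence (fun _ => C + C)
      (Eventually.of_forall fun i =>
        (hmeas i).stronglyMeasurable.integral_prod_left'.aestronglyMeasurable) ?_
      (integrable_const _) ?_
    · filter_upwards [hφM] with i hi
      filter_upwards [hi, hψM] with ω h1 h2
      rw [Real.norm_of_nonneg (integral_nonneg fun _ => abs_nonneg _)]
      have i1 := hu.integrableOn_ball_translate R (φ i ω)
      have i2 := hu.integrableOn_ball_translate R (ψ ω)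
      calc ∫ x in Metric.ball 0 R, |u (x - φ i ω) - u (x - ψ ω)| ∂ν
          ≤ ∫ x in Metric.ball 0 R, (|u (x - φ i ω)| + |u (x - ψ ω)|) ∂ν :=
            integral_mono (i1.sub i2).abs (i1.abs.add i2.abs) fun x => abs_sub _ _
        _ = _ := integral_add i1.abs i2.abs
        _ ≤ C + C := add_le_add (hu.setIntegral_abs_translate_le R h1)
            (hu.setIntegral_abs_translate_le R h2)
    · filter_upwards [hlim] with ω hω
      exact (hu.tendsto_setIntegral_abs_translate_sub R (ψ ω)).comp hω
  rw [integral_zero] at hdom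
  refine tendsto_of_tendsto_of_tendsto_of_le_of_le' tendsto_const_nhds hdom
    (Eventually.of_forall fun y => integral_nonneg fun _ => abs_nonneg _) ?_
  filter_upwards [hφM] with i hi
  have i1 := integrable_prod_translate hu hum (hφ i) hi R
  have i2 := integrable_prod_translate hu hum hψ hψM R
  have i3 : Integrable (fun p : E × Ω => |u (p.1 - φ i p.2) - u (p.1 - ψ p.2)|)
    ((ν.restrict (Metric.ball 0 R)).prod μ) := (i1.sub i2).abs
  rw [← integral_integral_swap
    (f := fun (x : E) (ω : Ω) => |u (x - φ i ω) - u (x - ψ ω)|) i3]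
  refine integral_mono_ae (i1.integral_prod_left.sub i2.integral_prod_left).abs
    i3.integral_prod_left ?_
  filter_upwards [i1.prod_right_ae, i2.prod_right_ae] with x h1 h2
  rw [← integral_sub h1 h2]
  exact abs_integral_le_integral_abs

end Translates

section Functional

variable {E : Type*} [NormedAddCommGroup E] [NormedSpace ℝ E] [FiniteDimensional ℝ E]
  [MeasurableSpace E] [BorelSpace E] {ν : Measure E} [ν.IsAddHaarMeasure]
  {Ω : Type*} [MeasurableSpace Ω] {μ : Measure Ω} [IsProbabilityMeasure μ]
  {Φ : (E → ℝ) → ℝ≥0∞} {u : E → ℝ}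

/-- **Jensen's inequality** for averages of translates. -/
lemma functional_integral_translate_le
    (hconv : ∀ u v : E → ℝ, LocallyIntegrable u ν → LocallyIntegrable v ν →
      ∀ t : ℝ, t ∈ Set.Icc (0:ℝ) 1 →
        Φ (fun x => t * u x + (1 - t) * v x) ≤
          ENNReal.ofReal t * Φ u + ENNReal.ofReal (1 - t) * Φ v)
    (htrans : ∀ u : E → ℝ, LocallyIntegrable u ν → ∀ y : E, Φ (fun x => u (x - y)) = Φ u)
    (hlsc : ∀ (un : ℕ → E → ℝ) (u : E → ℝ),
      (∀ n, LocallyIntegrable (un n) ν) → LocallyIntegrable u ν →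
      (∀ R > (0:ℝ), Tendsto
        (fun n => ∫ x in Metric.ball (0 : E) R, |un n x - u x| ∂ν) atTop (nhds 0)) →
      Φ u ≤ liminf (fun n => Φ (un n)) atTop)
    (hu : LocallyIntegrable u ν) (hum : Measurable u)
    {φ : Ω → E} (hφ : Measurable φ) {M : ℝ} (hM : ∀ᵐ ω ∂μ, ‖φ ω‖ ≤ M) :
    Φ (fun x => ∫ ω, u (x - φ ω) ∂μ) ≤ Φ u := by
  have hM0 : 0 ≤ M := by
    obtain ⟨ω, hω⟩ := hM.exists
    exact (norm_nonneg _).trans hω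
  have hφs : StronglyMeasurable φ := hφ.stronglyMeasurable
  let s : ℕ → SimpleFunc Ω E := hφs.approxBounded M
  have hsM (n : ℕ) : ∀ᵐ ω ∂μ, ‖s n ω‖ ≤ M :=
    Eventually.of_forall fun ω => hφs.norm_approxBounded_le hM0 n ω
  have hs (n : ℕ) : Φ (fun x => ∫ ω, u (x - s n ω) ∂μ) ≤ Φ u := by
    have hmem : ∑ y ∈ (s n).range, μ.real (s n ⁻¹' {y}) • (fun x => u (x - y)) ∈
        {f : E → ℝ | LocallyIntegrable f ν ∧ Φ f ≤ Φ u} :=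
      (convex_sublevel_of_convex_functional hconv (Φ u)).sum_mem
        (fun _ _ => measureReal_nonneg)
        (by simpa using ((s n).integral_comp_eq_sum (μ := μ) fun _ => (1 : ℝ)).symm)
        fun y _ => ⟨hu.translate y, (htrans u hu y).le⟩
    convert! hmem.2 using 2
    ext x
    rw [(s n).integral_comp_eq_sum fun y => u (x - y)]
    simp
  calc Φ (fun x => ∫ ω, u (x - φ ω) ∂μ)
      ≤ liminf (fun n => Φ (fun x => ∫ ω, u (x - s n ω) ∂μ)) atTop :=
        hlsc _ _ (fun n => locallyIntegrable_integral_translate hu hum (s n).measurable (hsM n))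
          (locallyIntegrable_integral_translate hu hum hφ hM) fun R _ =>
          tendsto_setIntegral_abs_integral_translate_sub hu hum (fun n => (s n).measurable) hφ
            (Eventually.of_forall hsM) hM (hφs.tendsto_approxBounded_ae hM) R
    _ ≤ liminf (fun _ : ℕ => Φ u) atTop := liminf_le_liminf (Eventually.of_forall hs)
    _ = Φ u := liminf_const _

end Functional

/-- A convex, translation invariant, `L¹_loc`-lower semicontinuous
functional `Φ : L¹_loc → [0, +∞]` decreases under mollification:
`Φ(ρ_ε ∗ u) ≤ Φ(u)` for every `ε > 0`, and `Φ(ρ_ε ∗ u) → Φ(u)` as `ε → 0⁺`. -/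
theorem stmt2 (N : ℕ) (hN : 1 ≤ N)
    (Φ : (EuclideanSpace ℝ (Fin N) → ℝ) → ℝ≥0∞)
    (hconv : ∀ u v : EuclideanSpace ℝ (Fin N) → ℝ,
      LocallyIntegrable u volume → LocallyIntegrable v volume →
      ∀ t : ℝ, t ∈ Set.Icc (0:ℝ) 1 →
        Φ (fun x => t * u x + (1 - t) * v x) ≤
          ENNReal.ofReal t * Φ u + ENNReal.ofReal (1 - t) * Φ v)
    (htrans : ∀ u : EuclideanSpace ℝ (Fin N) → ℝ, LocallyIntegrable u volume →
      ∀ y : EuclideanSpace ℝ (Fin N), Φ (fun x => u (x - y)) = Φ u)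
    (hlsc : ∀ (un : ℕ → EuclideanSpace ℝ (Fin N) → ℝ) (u : EuclideanSpace ℝ (Fin N) → ℝ),
      (∀ n, LocallyIntegrable (un n) volume) → LocallyIntegrable u volume →
      (∀ R > (0:ℝ), Tendsto
        (fun n => ∫ x in Metric.ball (0 : EuclideanSpace ℝ (Fin N)) R, |un n x - u x| ∂volume)
        atTop (nhds 0)) →
      Φ u ≤ liminf (fun n => Φ (un n)) atTop)
    (ρ : EuclideanSpace ℝ (Fin N) → ℝ)
    (hρnonneg : ∀ x, 0 ≤ ρ x)
    (hρsupp : HasCompactSupport ρ)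
    (hρint : Integrable ρ volume)
    (hρone : ∫ x, ρ x ∂volume = 1)
    (u : EuclideanSpace ℝ (Fin N) → ℝ) (hu : LocallyIntegrable u volume) :
    (∀ ε > (0:ℝ),
      Φ (fun x => ∫ y, (ε ^ N)⁻¹ * ρ (ε⁻¹ • y) * u (x - y) ∂volume) ≤ Φ u) ∧
    Tendsto (fun ε : ℝ => Φ (fun x => ∫ y, (ε ^ N)⁻¹ * ρ (ε⁻¹ • y) * u (x - y) ∂volume))
      (nhdsWithin 0 (Set.Ioi 0)) (nhds (Φ u)) := by
  set v : EuclideanSpace ℝ (Fin N) → ℝ := hu.aestronglyMeasurable.mk u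
  have huv : u =ᵐ[volume] v := hu.aestronglyMeasurable.ae_eq_mk
  have hvm : Measurable v := hu.aestronglyMeasurable.stronglyMeasurable_mk.measurable
  have hv : LocallyIntegrable v volume := hu.congr huv
  have hρm : AEMeasurable (fun z => ENNReal.ofReal (ρ z)) volume :=
    hρint.aemeasurable.ennreal_ofReal
  set μ : Measure (EuclideanSpace ℝ (Fin N)) :=
    volume.withDensity fun z => ENNReal.ofReal (ρ z) with hμ
  have : IsProbabilityMeasure μ := by
    constructor
    rw [hμ, withDensity_apply _ MeasurableSet.univ, Measure.restrict_univ,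
      ← ofReal_integral_eq_lintegral_ofReal hρint (Eventually.of_forall hρnonneg), hρone,
      ENNReal.ofReal_one]
  obtain ⟨M, hM⟩ := hρsupp.isCompact.isBounded.exists_norm_le
  have hMae : ∀ᵐ z ∂μ, ‖z‖ ≤ M := by
    refine (ae_withDensity_iff' hρm).2 (Eventually.of_forall fun z hz => hM z ?_)
    refine subset_tsupport ρ fun h => hz ?_
    simp [h]
  have hbound {ε : ℝ} (hε : 0 < ε) : ∀ᵐ z ∂μ, ‖ε • z‖ ≤ ε * M := by
    filter_upwards [hMae] with z hz
    rw [norm_smul, Real.norm_of_nonneg hε.le]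
    gcongr
  have hmollify {ε : ℝ} (hε : 0 < ε) :
      (fun x => ∫ y, (ε ^ N)⁻¹ * ρ (ε⁻¹ • y) * u (x - y) ∂volume) =
        fun x => ∫ z, v (x - ε • z) ∂μ := by
    ext x
    have h1 : ∫ y, (ε ^ N)⁻¹ * ρ (ε⁻¹ • y) * u (x - y) =
        ∫ y, (ε ^ N)⁻¹ * ρ (ε⁻¹ • y) * v (x - y) := by
      refine integral_congr_ae ?_
      filter_upwards [(Measure.measurePreserving_sub_left volume x).quasiMeasurePreserving.ae_eq_comp
        huv] with y hy
      simp only [Function.comp_apply] at hy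
      rw [hy]
    have h2 := Measure.integral_comp_inv_smul_of_nonneg volume
      (fun z => (ε ^ N)⁻¹ * ρ z * v (x - ε • z)) hε.le
    simp only [smul_inv_smul₀ hε.ne', finrank_euclideanSpace_fin] at h2
    rw [h1, h2, hμ, integral_withDensity_eq_integral_toReal_smul₀ hρm
      (Eventually.of_forall fun _ => ENNReal.ofReal_lt_top), smul_eq_mul, ← integral_const_mul]
    refine integral_congr_ae (Eventually.of_forall fun z => ?_)
    have : ε ^ N ≠ 0 := (pow_pos hε N).ne'
    simp only [ENNReal.toReal_ofReal (hρnonneg z), smul_eq_mul]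
    field_simp
  have hle : ∀ ε > (0:ℝ),
      Φ (fun x => ∫ y, (ε ^ N)⁻¹ * ρ (ε⁻¹ • y) * u (x - y) ∂volume) ≤ Φ u := fun ε hε => by
    rw [hmollify hε, functional_congr_ae hlsc hu huv]
    exact functional_integral_translate_le hconv htrans hlsc hv hvm
      (measurable_const_smul ε) (hbound hε)
  refine ⟨hle, tendsto_of_seq_tendsto fun e he => ?_⟩
  have he0 : Tendsto e atTop (nhds 0) := he.mono_right nhdsWithin_le_nhds
  have hepos : ∀ᶠ n in atTop, 0 < e n := he.eventually self_mem_nhdsWithin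
  refine tendsto_of_le_liminf_of_limsup_le ?_
    ((limsup_le_limsup (hepos.mono fun n hn => hle _ hn)).trans_eq (limsup_const _))
  have hbound' (n : ℕ) : ∀ᵐ z ∂μ, ‖e n • z‖ ≤ |e n| * M := by
    filter_upwards [hMae] with z hz
    rw [norm_smul, Real.norm_eq_abs]
    gcongr
  have hM0 : 0 ≤ M := by
    obtain ⟨z, hz⟩ := hMae.exists
    exact (norm_nonneg _).trans hz
  have he1 : ∀ᶠ n in atTop, |e n| ≤ 1 :=
    (by simpa using he0.abs : Tendsto (fun n => |e n|) atTop (nhds 0)).eventually_le_const one_pos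
  calc Φ u = Φ v := functional_congr_ae hlsc hu huv
    _ ≤ liminf (fun n => Φ fun x => ∫ z, v (x - e n • z) ∂μ) atTop := by
        refine hlsc _ _ (fun n => locallyIntegrable_integral_translate hv hvm
          (measurable_const_smul (e n)) (hbound' n)) hv fun R _ => ?_
        have h := tendsto_setIntegral_abs_integral_translate_sub (ν := volume) (μ := μ)
          (l := atTop) (φ := fun n z => e n • z) (ψ := fun _ => 0) (M := M) hv hvm
          (fun n => measurable_const_smul (e n)) measurable_const
          (he1.mono fun n hn => (hbound' n).mono fun z hz =>
            hz.trans (mul_le_of_le_one_left hM0 hn))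
          (by simpa using hM0)
          (Eventually.of_forall fun z => by simpa using he0.smul_const z) R
        simpa using h
    _ = _ := liminf_congr (hepos.mono fun n hn => by
        rw [Function.comp_apply, hmollify hn])
end

section
/- Let N ≥ 1 and let J be a set function on the Lebesgue-measurable subsets of ℝ^N with values in [0, +∞] which satisfies J(∅) = 0, is insensitive to null sets, is submodular, and is lower semicontinuous with respect to L¹_loc convergence of sets. Let E ⊆ ℝ^N be nonempty and bounded and let h > 0. Then the functional 𝓔(F) := J(F) + (1/h)∫_F d_E(x) dx, defined over Lebesgue-measurable sets F, admits a minimizer; moreover there exist a minimal minimizer F⁻ and a maximal minimizer F⁺, i.e. minimizers such that |F⁻ \ G| = 0 and |G \ F⁺| = 0 for every minimizer G of 𝓔. -/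
open MeasureTheory Filter Set
open scoped ENNReal

/-- The signed distance function to the boundary of `E`:
`d_E(x) = dist(x, E) - dist(x, ℝ^N \ E)`. -/
noncomputable def sdist {N : ℕ} (E : Set (EuclideanSpace ℝ (Fin N)))
    (x : EuclideanSpace ℝ (Fin N)) : ℝ :=
  Metric.infDist x E - Metric.infDist x Eᶜ

/-- The (extended-real-valued) integral `∫_F f dx`, defined as the difference of the
lower integrals of the positive and negative parts; it takes values in `(−∞, +∞]`
whenever the negative part of `f` is integrable on `F`. -/
noncomputable def enInt {N : ℕ} (f : EuclideanSpace ℝ (Fin N) → ℝ)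
    (F : Set (EuclideanSpace ℝ (Fin N))) : EReal :=
  ((∫⁻ x in F, ENNReal.ofReal (f x) ∂volume : ℝ≥0∞) : EReal) -
    ((∫⁻ x in F, ENNReal.ofReal (-f x) ∂volume : ℝ≥0∞) : EReal)

/-- The incremental energy `𝓔(F) = J(F) + ∫_F f dx`. -/
noncomputable def ene {N : ℕ} (J : Set (EuclideanSpace ℝ (Fin N)) → ℝ≥0∞)
    (f : EuclideanSpace ℝ (Fin N) → ℝ) (F : Set (EuclideanSpace ℝ (Fin N))) : EReal :=
  (J F : EReal) + enInt f F

/-- `F` is a minimizer of `𝓔` among Lebesgue-measurable sets. -/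
def IsMinimizer {N : ℕ} (𝓔 : Set (EuclideanSpace ℝ (Fin N)) → EReal)
    (F : Set (EuclideanSpace ℝ (Fin N))) : Prop :=
  MeasurableSet F ∧ ∀ G, MeasurableSet G → 𝓔 F ≤ 𝓔 G

/-- `F` is a minimal minimizer of `𝓔`: a minimizer contained (up to null sets)
in every other minimizer. -/
def IsMinimalMinimizer {N : ℕ} (𝓔 : Set (EuclideanSpace ℝ (Fin N)) → EReal)
    (F : Set (EuclideanSpace ℝ (Fin N))) : Prop :=
  IsMinimizer 𝓔 F ∧ ∀ G, IsMinimizer 𝓔 G → volume (F \ G) = 0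

/-- `F` is a maximal minimizer of `𝓔`: a minimizer containing (up to null sets)
every other minimizer. -/
def IsMaximalMinimizer {N : ℕ} (𝓔 : Set (EuclideanSpace ℝ (Fin N)) → EReal)
    (F : Set (EuclideanSpace ℝ (Fin N))) : Prop :=
  IsMinimizer 𝓔 F ∧ ∀ G, IsMinimizer 𝓔 G → volume (G \ F) = 0

theorem ENNReal.liminf_add_liminf_le_liminf_add (u v : ℕ → ℝ≥0∞) :
    liminf u atTop + liminf v atTop ≤ liminf (fun n => u n + v n) atTop := by
  have hmono : ∀ w : ℕ → ℝ≥0∞, Monotone fun n => ⨅ i ≥ n, w i := fun w m n hmn =>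
    le_iInf₂ fun i hi => iInf₂_le i (hmn.trans hi)
  rw [liminf_eq_iSup_iInf_of_nat, liminf_eq_iSup_iInf_of_nat,
    ENNReal.iSup_add_iSup_of_monotone (hmono u) (hmono v)]
  refine iSup_le fun n => le_liminf_of_le (by isBoundedDefault) ?_
  filter_upwards [eventually_ge_atTop n] with i hi
  exact add_le_add (iInf₂_le i hi) (iInf₂_le i hi)

/-- A submodular set function on measurable sets which is lower semicontinuous along monotone
sequences of measurable sets. -/
structure IsMonotoneLscSubmodular {X : Type*} [MeasurableSpace X] (e : Set X → ℝ≥0∞) :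
    Prop where
  union_add_inter_le : ∀ A B, MeasurableSet A → MeasurableSet B →
    e (A ∪ B) + e (A ∩ B) ≤ e A + e B
  iUnion_le_liminf : ∀ A : ℕ → Set X, (∀ n, MeasurableSet (A n)) → Monotone A →
    e (⋃ n, A n) ≤ liminf (fun n => e (A n)) atTop
  iInter_le_liminf : ∀ A : ℕ → Set X, (∀ n, MeasurableSet (A n)) → Antitone A →
    e (⋂ n, A n) ≤ liminf (fun n => e (A n)) atTop

/-- `F` is measurable and minimizes `e` among measurable sets. -/
def MinimizesOnMeasurable {X : Type*} [MeasurableSpace X] (e : Set X → ℝ≥0∞) (F : Set X) :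
    Prop :=
  MeasurableSet F ∧ ∀ G, MeasurableSet G → e F ≤ e G

section Abstract

variable {X : Type*} [MeasurableSpace X]

theorem MeasureTheory.Measure.isMonotoneLscSubmodular (ν : Measure X) :
    IsMonotoneLscSubmodular (fun A => ν A) where
  union_add_inter_le A B _ hB := (measure_union_add_inter A hB).le
  iUnion_le_liminf A _ hm := (tendsto_measure_iUnion_atTop hm).liminf_eq.ge
  iInter_le_liminf A _ _ := le_liminf_of_le (by isBoundedDefault)
    (Eventually.of_forall fun n => measure_mono (iInter_subset A n))

theorem minimizesOnMeasurable_comp_compl_iff {e : Set X → ℝ≥0∞} {F : Set X} :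
    MinimizesOnMeasurable (fun A => e Aᶜ) F ↔ MinimizesOnMeasurable e Fᶜ := by
  refine and_congr MeasurableSet.compl_iff.symm ⟨fun h G hG => ?_, fun h G hG => h _ hG.compl⟩
  simpa using h Gᶜ hG.compl

namespace IsMonotoneLscSubmodular

variable {e e' : Set X → ℝ≥0∞}

theorem comp_compl (he : IsMonotoneLscSubmodular e) :
    IsMonotoneLscSubmodular (fun A => e Aᶜ) where
  union_add_inter_le A B hA hB := by
    have := he.union_add_inter_le Aᶜ Bᶜ hA.compl hB.compl
    rwa [← compl_inter, ← compl_union, add_comm] at this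
  iUnion_le_liminf A hA hm := by
    rw [compl_iUnion]
    exact he.iInter_le_liminf _ (fun n => (hA n).compl)
      fun m n hmn => compl_subset_compl.2 (hm hmn)
  iInter_le_liminf A hA hm := by
    rw [compl_iInter]
    exact he.iUnion_le_liminf _ (fun n => (hA n).compl)
      fun m n hmn => compl_subset_compl.2 (hm hmn)

theorem add (he : IsMonotoneLscSubmodular e) (he' : IsMonotoneLscSubmodular e') :
    IsMonotoneLscSubmodular (fun A => e A + e' A) where
  union_add_inter_le A B hA hB := by
    have h := add_le_add (he.union_add_inter_le A B hA hB) (he'.union_add_inter_le A B hA hB)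
    rwa [add_add_add_comm, add_add_add_comm (e A)] at h
  iUnion_le_liminf A hA hm :=
    (add_le_add (he.iUnion_le_liminf A hA hm) (he'.iUnion_le_liminf A hA hm)).trans
      (ENNReal.liminf_add_liminf_le_liminf_add _ _)
  iInter_le_liminf A hA hm :=
    (add_le_add (he.iInter_le_liminf A hA hm) (he'.iInter_le_liminf A hA hm)).trans
      (ENNReal.liminf_add_liminf_le_liminf_add _ _)

/-- The excess over a finite lower bound is countably subadditive under unions. -/
theorem iUnion_le_add_tsum (he : IsMonotoneLscSubmodular e) {m : ℝ≥0∞} (hm : m ≠ ∞)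
    (hle : ∀ A, MeasurableSet A → m ≤ e A) {F : ℕ → Set X} (hF : ∀ n, MeasurableSet (F n))
    {δ : ℕ → ℝ≥0∞} (hδ : ∀ n, e (F n) ≤ m + δ n) :
    e (⋃ n, F n) ≤ m + ∑' n, δ n := by
  have hmeas : ∀ n, MeasurableSet (accumulate F n) := fun n =>
    MeasurableSet.biUnion (to_countable _) fun i _ => hF i
  have hfin : ∀ n, e (accumulate F n) ≤ m + ∑ i ∈ Finset.range (n + 1), δ i := by
    intro n
    induction n with
    | zero => simpa using hδ 0
    | succ n ih =>
      rw [accumulate_succ, Finset.sum_range_succ]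
      have h1 := he.union_add_inter_le _ _ (hmeas n) (hF (n + 1))
      have h2 := hle _ ((hmeas n).inter (hF (n + 1)))
      refine (ENNReal.add_le_add_iff_right hm).1 ?_
      calc e (accumulate F n ∪ F (n + 1)) + m
          ≤ (m + ∑ i ∈ Finset.range (n + 1), δ i) + (m + δ (n + 1)) :=
            (add_le_add le_rfl h2).trans (h1.trans (add_le_add ih (hδ _)))
        _ = m + (∑ i ∈ Finset.range (n + 1), δ i + δ (n + 1)) + m := by ring
  rw [← iUnion_accumulate]
  refine (he.iUnion_le_liminf _ hmeas monotone_accumulate).trans ?_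
  refine liminf_le_of_le (by isBoundedDefault) fun b hb => ?_
  obtain ⟨n, hn⟩ := hb.exists
  exact hn.trans ((hfin n).trans (add_le_add le_rfl (ENNReal.sum_le_tsum _)))

theorem exists_minimizes (he : IsMonotoneLscSubmodular e) {A₀ : Set X}
    (hA₀ : MeasurableSet A₀) (hfin : e A₀ ≠ ∞) : ∃ F, MinimizesOnMeasurable e F := by
  let m : ℝ≥0∞ := ⨅ A : {A : Set X // MeasurableSet A}, e A
  have hle : ∀ A, MeasurableSet A → m ≤ e A := fun A hA =>
    iInf_le (fun A : {A : Set X // MeasurableSet A} => e A) ⟨A, hA⟩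
  have hm : m ≠ ∞ := ne_top_of_le_ne_top hfin (hle A₀ hA₀)
  obtain ⟨δ, hδpos, hδsum⟩ := ENNReal.exists_pos_sum_of_countable one_ne_zero ℕ
  have hex : ∀ n, ∃ A, MeasurableSet A ∧ e A ≤ m + δ n := by
    intro n
    have hlt : m < m + δ n :=
      ENNReal.lt_add_right hm (ENNReal.coe_ne_zero.2 (hδpos n).ne')
    obtain ⟨A, hA⟩ := iInf_lt_iff.1 hlt
    exact ⟨A, A.2, hA.le⟩
  choose F hF hFe using hex
  let G : ℕ → Set X := fun k => ⋃ n, F (n + k)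
  have hG : ∀ k, MeasurableSet (G k) := fun k => MeasurableSet.iUnion fun n => hF _
  have hGe : ∀ k, e (G k) ≤ m + ∑' n, (δ (n + k) : ℝ≥0∞) := fun k =>
    he.iUnion_le_add_tsum hm hle (fun n => hF (n + k)) fun n => hFe (n + k)
  have hanti : Antitone G := by
    intro k l hkl x hx
    obtain ⟨n, hn⟩ := mem_iUnion.1 hx
    refine mem_iUnion.2 ⟨n + (l - k), ?_⟩
    rwa [show n + (l - k) + k = n + l by omega]
  refine ⟨⋂ k, G k, MeasurableSet.iInter hG, fun A hA => le_trans ?_ (hle A hA)⟩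
  have htail : Tendsto (fun k => m + ∑' n, (δ (n + k) : ℝ≥0∞)) atTop (nhds (m + 0)) :=
    tendsto_const_nhds.add
      (ENNReal.tendsto_sum_nat_add (fun n => (δ n : ℝ≥0∞)) (hδsum.trans ENNReal.one_lt_top).ne)
  rw [add_zero] at htail
  calc e (⋂ k, G k) ≤ liminf (fun k => e (G k)) atTop := he.iInter_le_liminf G hG hanti
    _ ≤ liminf (fun k => m + ∑' n, (δ (n + k) : ℝ≥0∞)) atTop :=
        liminf_le_liminf (Eventually.of_forall hGe)
    _ = m := htail.liminf_eq

theorem minimizes_iUnion (he : IsMonotoneLscSubmodular e) {A₀ : Set X}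
    (hA₀ : MeasurableSet A₀) (hfin : e A₀ ≠ ∞) {F : ℕ → Set X}
    (hF : ∀ n, MinimizesOnMeasurable e (F n)) : MinimizesOnMeasurable e (⋃ n, F n) := by
  refine ⟨MeasurableSet.iUnion fun n => (hF n).1, fun A hA => le_trans ?_ ((hF 0).2 A hA)⟩
  have h := he.iUnion_le_add_tsum (m := e (F 0)) (δ := fun _ => 0)
    (ne_top_of_le_ne_top hfin ((hF 0).2 A₀ hA₀)) (hF 0).2 (fun n => (hF n).1)
    (fun n => by simpa using (hF n).2 _ (hF 0).1)
  simpa using h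

theorem exists_maximal_minimizes (he : IsMonotoneLscSubmodular e) {A₀ : Set X}
    (hA₀ : MeasurableSet A₀) (hfin : e A₀ ≠ ∞) (μ : Measure X) [SFinite μ] :
    ∃ F, MinimizesOnMeasurable e F ∧ ∀ G, MinimizesOnMeasurable e G → μ (G \ F) = 0 := by
  obtain ⟨ν, hν, hμν⟩ : ∃ ν : Measure X, IsFiniteMeasure ν ∧ μ ≪ ν :=
    ⟨μ.toFinite, inferInstance, absolutelyContinuous_toFinite μ⟩
  obtain ⟨F₀, hF₀⟩ := he.exists_minimizes hA₀ hfin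
  let S : Set ℝ≥0∞ := (fun A => ν A) '' {A | MinimizesOnMeasurable e A}
  obtain ⟨u, -, hu, huS⟩ := exists_seq_tendsto_sSup (S := S) ⟨_, F₀, hF₀, rfl⟩
    (OrderTop.bddAbove S)
  choose F hF hFu using huS
  have hU := he.minimizes_iUnion hA₀ hfin hF
  refine ⟨⋃ n, F n, hU, fun G hG => hμν ?_⟩
  have hGU : MinimizesOnMeasurable e (G ∪ ⋃ n, F n) := by
    have h := he.minimizes_iUnion hA₀ hfin (F := fun n => Nat.casesOn n G F)
      (fun n => by cases n with
        | zero => exact hG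
        | succ n => exact hF n)
    have heq : (⋃ n : ℕ, (Nat.casesOn n G F : Set X)) = G ∪ ⋃ n, F n :=
      (union_iUnion_nat_succ (fun n : ℕ => (Nat.casesOn n G F : Set X))).symm
    rwa [heq] at h
  have h1 : ν (G ∪ ⋃ n, F n) ≤ sSup S := le_sSup ⟨_, hGU, rfl⟩
  have h2 : sSup S ≤ ν (⋃ n, F n) := le_of_tendsto' hu fun n => by
    rw [← hFu n]
    exact measure_mono (subset_iUnion F n)
  have h3 : ν (⋃ n, F n) + ν (G \ ⋃ n, F n) = ν (G ∪ ⋃ n, F n) := by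
    rw [← measure_union disjoint_sdiff_right (hG.1.diff hU.1), union_sdiff_self, union_comm]
  have h4 : ν (⋃ n, F n) + ν (G \ ⋃ n, F n) ≤ ν (⋃ n, F n) + 0 := by
    rw [h3, add_zero]
    exact h1.trans h2
  exact nonpos_iff_eq_zero.1 ((ENNReal.add_le_add_iff_left (measure_ne_top ν _)).1 h4)

theorem exists_minimal_minimizes (he : IsMonotoneLscSubmodular e) {A₀ : Set X}
    (hA₀ : MeasurableSet A₀) (hfin : e A₀ ≠ ∞) (μ : Measure X) [SFinite μ] :
    ∃ F, MinimizesOnMeasurable e F ∧ ∀ G, MinimizesOnMeasurable e G → μ (F \ G) = 0 := by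
  obtain ⟨F, hF, hmax⟩ := he.comp_compl.exists_maximal_minimizes hA₀.compl
    (by simpa using hfin) μ
  refine ⟨Fᶜ, minimizesOnMeasurable_comp_compl_iff.1 hF, fun G hG => ?_⟩
  have h := hmax Gᶜ (minimizesOnMeasurable_comp_compl_iff.2 (by simpa using hG))
  rwa [sdiff_eq, inter_comm, ← sdiff_eq] at h

end IsMonotoneLscSubmodular

end Abstract

theorem isMonotoneLscSubmodular_of_lsc_locally {N : ℕ}
    {J : Set (EuclideanSpace ℝ (Fin N)) → ℝ≥0∞}
    (hJsub : ∀ A B : Set (EuclideanSpace ℝ (Fin N)), MeasurableSet A → MeasurableSet B →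
      J (A ∪ B) + J (A ∩ B) ≤ J A + J B)
    (hJlsc : ∀ (En : ℕ → Set (EuclideanSpace ℝ (Fin N))) (E₀ : Set (EuclideanSpace ℝ (Fin N))),
      (∀ n, MeasurableSet (En n)) → MeasurableSet E₀ →
      (∀ R > (0:ℝ), Tendsto (fun n => volume (symmDiff (En n) E₀ ∩ Metric.ball 0 R))
        atTop (nhds 0)) →
      J E₀ ≤ liminf (fun n => J (En n)) atTop) :
    IsMonotoneLscSubmodular J where
  union_add_inter_le := hJsub
  iUnion_le_liminf A hA hm := by
    have hU : MeasurableSet (⋃ n, A n) := MeasurableSet.iUnion hA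
    refine hJlsc A _ hA hU fun R _ => ?_
    have heq : ∀ n, symmDiff (A n) (⋃ n, A n) = (⋃ n, A n) \ A n := fun n =>
      symmDiff_of_le (subset_iUnion A n)
    simp only [heq]
    have h := tendsto_measure_iInter_atTop (μ := volume)
      (s := fun n => ((⋃ n, A n) \ A n) ∩ Metric.ball 0 R)
      (fun n => ((hU.diff (hA n)).inter Metric.isOpen_ball.measurableSet).nullMeasurableSet)
      (fun m n hmn => inter_subset_inter_left _ (sdiff_subset_sdiff_right (hm hmn)))
      ⟨0, ((measure_mono inter_subset_right).trans_lt measure_ball_lt_top).ne⟩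
    rwa [← iInter_inter, ← sdiff_iUnion, sdiff_self, empty_inter, measure_empty] at h
  iInter_le_liminf A hA hm := by
    have hI : MeasurableSet (⋂ n, A n) := MeasurableSet.iInter hA
    refine hJlsc A _ hA hI fun R _ => ?_
    have heq : ∀ n, symmDiff (A n) (⋂ n, A n) = A n \ ⋂ n, A n := fun n =>
      symmDiff_of_ge (iInter_subset A n)
    simp only [heq]
    have h := tendsto_measure_iInter_atTop (μ := volume)
      (s := fun n => (A n \ ⋂ n, A n) ∩ Metric.ball 0 R)
      (fun n => (((hA n).diff hI).inter Metric.isOpen_ball.measurableSet).nullMeasurableSet)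
      (fun m n hmn => inter_subset_inter_left _ (sdiff_subset_sdiff_left (hm hmn)))
      ⟨0, ((measure_mono inter_subset_right).trans_lt measure_ball_lt_top).ne⟩
    have hempty : ⋂ n, (A n \ ⋂ n, A n) ∩ Metric.ball 0 R = ∅ := by
      simp only [sdiff_eq, ← iInter_inter, inter_compl_self, empty_inter]
    rwa [hempty, measure_empty] at h

theorem continuous_sdist {N : ℕ} (E : Set (EuclideanSpace ℝ (Fin N))) :
    Continuous (sdist E) :=
  (Metric.continuous_infDist_pt E).sub (Metric.continuous_infDist_pt Eᶜ)

theorem sdist_nonneg_of_notMem {N : ℕ} {E : Set (EuclideanSpace ℝ (Fin N))}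
    {x : EuclideanSpace ℝ (Fin N)} (hx : x ∉ E) : 0 ≤ sdist E x := by
  rw [sdist, Metric.infDist_zero_of_mem (s := Eᶜ) hx, sub_zero]
  exact Metric.infDist_nonneg

theorem lintegral_ofReal_neg_sdist_div_ne_top {N : ℕ} {E : Set (EuclideanSpace ℝ (Fin N))}
    (hE : Bornology.IsBounded E) {h : ℝ} (hh : 0 < h) :
    ∫⁻ x, ENNReal.ofReal (-(sdist E x / h)) ≠ ∞ := by
  have hint : IntegrableOn (fun x => -(sdist E x / h)) (closure E) volume :=
    (((continuous_sdist E).div_const h).neg).continuousOn.integrableOn_compact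
      hE.isCompact_closure
  have hsupp : Function.support (fun x => ENNReal.ofReal (-(sdist E x / h))) ⊆ closure E := by
    intro x hx
    by_contra hxE
    refine hx (ENNReal.ofReal_of_nonpos (neg_nonpos.2 (div_nonneg ?_ hh.le)))
    exact sdist_nonneg_of_notMem fun hx' => hxE (subset_closure hx')
  rw [← setLIntegral_eq_of_support_subset hsupp]
  exact hint.lintegral_lt_top.ne

/-- The energy, normalized by adding the total mass of the negative part of `f`. -/
noncomputable def shiftedEnergy {N : ℕ} (J : Set (EuclideanSpace ℝ (Fin N)) → ℝ≥0∞)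
    (f : EuclideanSpace ℝ (Fin N) → ℝ) (F : Set (EuclideanSpace ℝ (Fin N))) : ℝ≥0∞ :=
  J F + volume.withDensity (fun x => ENNReal.ofReal (f x)) F +
    volume.withDensity (fun x => ENNReal.ofReal (-f x)) Fᶜ

theorem ene_add_eq_shiftedEnergy {N : ℕ} {J : Set (EuclideanSpace ℝ (Fin N)) → ℝ≥0∞}
    {f : EuclideanSpace ℝ (Fin N) → ℝ} (hf : ∫⁻ x, ENNReal.ofReal (-f x) ≠ ∞)
    {F : Set (EuclideanSpace ℝ (Fin N))} (hF : MeasurableSet F) :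
    ene J f F + ((∫⁻ x, ENNReal.ofReal (-f x)).toReal : EReal) = shiftedEnergy J f F := by
  rw [shiftedEnergy, withDensity_apply _ hF, withDensity_apply _ hF.compl, ene, enInt]
  have hsum := lintegral_add_compl (μ := volume) (fun x => ENNReal.ofReal (-f x)) hF
  rw [← hsum] at hf ⊢
  obtain ⟨ha, hb⟩ := ENNReal.add_ne_top.1 hf
  generalize (∫⁻ x in F, ENNReal.ofReal (-f x)) = a at *
  generalize (∫⁻ x in Fᶜ, ENNReal.ofReal (-f x)) = b at *
  generalize (∫⁻ x in F, ENNReal.ofReal (f x)) = c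
  generalize J F = j
  lift a to NNReal using ha
  lift b to NNReal using hb
  have hc : ∀ r : NNReal, ((r : ℝ≥0∞) : EReal) = ((r : ℝ) : EReal) := fun _ => rfl
  rw [← add_sub_assoc, ← EReal.coe_ennreal_add]
  generalize j + c = s
  rw [EReal.coe_ennreal_add, ← ENNReal.coe_add, ENNReal.coe_toReal, hc a, hc b]
  induction s with
  | top => simp
  | coe s =>
    rw [hc s]
    norm_cast
    push_cast
    ring

theorem isMinimizer_ene_iff {N : ℕ} {J : Set (EuclideanSpace ℝ (Fin N)) → ℝ≥0∞}
    {f : EuclideanSpace ℝ (Fin N) → ℝ} (hf : ∫⁻ x, ENNReal.ofReal (-f x) ≠ ∞)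
    {F : Set (EuclideanSpace ℝ (Fin N))} :
    IsMinimizer (ene J f) F ↔ MinimizesOnMeasurable (shiftedEnergy J f) F := by
  refine and_congr_right fun hF => forall₂_congr fun G hG => ?_
  rw [← EReal.coe_ennreal_le_coe_ennreal_iff, ← ene_add_eq_shiftedEnergy hf hF,
    ← ene_add_eq_shiftedEnergy hf hG]
  refine ⟨fun h => add_le_add_left h _, fun h => ?_⟩
  simpa only [EReal.add_sub_cancel_right] using
    EReal.sub_le_sub h (le_refl ((∫⁻ x, ENNReal.ofReal (-f x)).toReal : EReal))

/-- If `J` is a generalized perimeter-type functional (null-insensitive,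
submodular, `L¹_loc`-lower semicontinuous, with `J ∅ = 0`), `E` is nonempty and bounded and
`h > 0`, then `𝓔(F) = J(F) + (1/h)∫_F d_E dx` admits a minimizer, and in fact a minimal
and a maximal minimizer. -/
theorem stmt3 (N : ℕ) (hN : 1 ≤ N)
    (J : Set (EuclideanSpace ℝ (Fin N)) → ℝ≥0∞)
    (hJempty : J ∅ = 0)
    (hJnull : ∀ A B : Set (EuclideanSpace ℝ (Fin N)), MeasurableSet A → MeasurableSet B →
      volume (symmDiff A B) = 0 → J A = J B)
    (hJsub : ∀ A B : Set (EuclideanSpace ℝ (Fin N)), MeasurableSet A → MeasurableSet B →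
      J (A ∪ B) + J (A ∩ B) ≤ J A + J B)
    (hJlsc : ∀ (En : ℕ → Set (EuclideanSpace ℝ (Fin N))) (E₀ : Set (EuclideanSpace ℝ (Fin N))),
      (∀ n, MeasurableSet (En n)) → MeasurableSet E₀ →
      (∀ R > (0:ℝ), Tendsto (fun n => volume (symmDiff (En n) E₀ ∩ Metric.ball 0 R))
        atTop (nhds 0)) →
      J E₀ ≤ liminf (fun n => J (En n)) atTop)
    (E : Set (EuclideanSpace ℝ (Fin N))) (hEne : E.Nonempty) (hEbd : Bornology.IsBounded E)
    (h : ℝ) (hh : 0 < h) :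
    (∃ F, IsMinimizer (ene J (fun x => sdist E x / h)) F) ∧
    (∃ Fm, IsMinimalMinimizer (ene J (fun x => sdist E x / h)) Fm) ∧
    (∃ FM, IsMaximalMinimizer (ene J (fun x => sdist E x / h)) FM) := by
  have hf : ∫⁻ x, ENNReal.ofReal (-(sdist E x / h)) ≠ ∞ :=
    lintegral_ofReal_neg_sdist_div_ne_top hEbd hh
  have he : IsMonotoneLscSubmodular (shiftedEnergy J fun x => sdist E x / h) :=
    ((isMonotoneLscSubmodular_of_lsc_locally hJsub hJlsc).add
      (Measure.isMonotoneLscSubmodular _)).add (Measure.isMonotoneLscSubmodular _).comp_compl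
  have hfin : shiftedEnergy J (fun x => sdist E x / h) ∅ ≠ ∞ := by
    simpa [shiftedEnergy, hJempty] using hf
  simp only [IsMinimalMinimizer, IsMaximalMinimizer, isMinimizer_ene_iff hf]
  exact ⟨he.exists_minimizes MeasurableSet.empty hfin,
    he.exists_minimal_minimizes MeasurableSet.empty hfin volume,
    he.exists_maximal_minimizes MeasurableSet.empty hfin volume⟩
end

section
/- Let N ≥ 1, let J be a submodular set function on the Lebesgue-measurable subsets of ℝ^N with values in [0, +∞], and let f : ℝ^N → ℝ be measurable with negative part f⁻ ∈ L¹(ℝ^N). If E₁ and E₂ both minimize the functional 𝓔(F) := J(F) + ∫_F f dx over Lebesgue-measurable sets F, then E₁ ∪ E₂ and E₁ ∩ E₂ are also minimizers of 𝓔. -/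
open MeasureTheory Filter Set
open scoped ENNReal

/-- The integral of a nonnegative function is a modular set function. -/
theorem setLIntegral_union_add_inter {α : Type*} [MeasurableSpace α] {μ : Measure α}
    (g : α → ℝ≥0∞) {A B : Set α} (hA : MeasurableSet A) (hB : MeasurableSet B) :
    ∫⁻ x in A ∪ B, g x ∂μ + ∫⁻ x in A ∩ B, g x ∂μ =
      ∫⁻ x in A, g x ∂μ + ∫⁻ x in B, g x ∂μ := by
  rw [← withDensity_apply g (hA.union hB), ← withDensity_apply g (hA.inter hB),
    ← withDensity_apply g hA, ← withDensity_apply g hB]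
  exact measure_union_add_inter A hB

theorem EReal.coe_ennreal_sub_le_sub_iff {a b q r : ℝ≥0∞} (hq : q ≠ ∞) (hr : r ≠ ∞) :
    (a : EReal) - q ≤ (b : EReal) - r ↔ a + r ≤ b + q := by
  have hq' : (q : EReal) ≠ ⊤ := by simpa using hq
  have hr' : (r : EReal) ≠ ⊤ := by simpa using hr
  rw [EReal.sub_le_iff_le_add (.inl (EReal.coe_ennreal_ne_bot q)) (.inl hq'),
    sub_eq_add_neg, add_right_comm, ← sub_eq_add_neg,
    EReal.le_sub_iff_add_le (.inl (EReal.coe_ennreal_ne_bot r)) (.inl hr')]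
  norm_cast

/-- If `P - q` is minimal at `P₁ - q₁` and at `P₂ - q₂`, where `P` is submodular and `q` is
modular, then it is minimal at `PU - qU`; all inequalities are written without subtraction. -/
theorem ENNReal.add_le_add_of_submodular {P₁ P₂ PU PI PF q₁ q₂ qU qI qF : ℝ≥0∞}
    (hq₁ : q₁ ≠ ∞) (hq₂ : q₂ ≠ ∞) (hqU : qU ≠ ∞) (hqI : qI ≠ ∞) (hqF : qF ≠ ∞)
    (hP : PU + PI ≤ P₁ + P₂) (hq : qU + qI = q₁ + q₂)
    (h₁F : P₁ + qF ≤ PF + q₁) (h₂F : P₂ + qF ≤ PF + q₂) (h₂I : P₂ + qI ≤ PI + q₂) :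
    PU + qF ≤ PF + qU := by
  rcases eq_or_ne PF ∞ with rfl | hPF
  · simp
  have hP₁ : P₁ ≠ ∞ :=
    ne_top_of_le_ne_top (ENNReal.add_ne_top.2 ⟨hPF, hq₁⟩) (le_self_add.trans h₁F)
  have hP₂ : P₂ ≠ ∞ :=
    ne_top_of_le_ne_top (ENNReal.add_ne_top.2 ⟨hPF, hq₂⟩) (le_self_add.trans h₂F)
  obtain ⟨hPU, hPI⟩ := ENNReal.add_ne_top.1
    (ne_top_of_le_ne_top (ENNReal.add_ne_top.2 ⟨hP₁, hP₂⟩) hP)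
  lift P₁ to NNReal using hP₁
  lift P₂ to NNReal using hP₂
  lift PU to NNReal using hPU
  lift PI to NNReal using hPI
  lift PF to NNReal using hPF
  lift q₁ to NNReal using hq₁
  lift q₂ to NNReal using hq₂
  lift qU to NNReal using hqU
  lift qI to NNReal using hqI
  lift qF to NNReal using hqF
  norm_cast at *
  rw [← NNReal.coe_le_coe] at *
  rw [← NNReal.coe_inj] at hq
  push_cast at *
  linarith

/-- If `J` is submodular and `f` has integrable negative part, then the
union and the intersection of two minimizers of `𝓔(F) = J(F) + ∫_F f dx` are again
minimizers. -/
theorem stmt4 (N : ℕ) (hN : 1 ≤ N)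
    (J : Set (EuclideanSpace ℝ (Fin N)) → ℝ≥0∞)
    (hJsub : ∀ A B : Set (EuclideanSpace ℝ (Fin N)), MeasurableSet A → MeasurableSet B →
      J (A ∪ B) + J (A ∩ B) ≤ J A + J B)
    (f : EuclideanSpace ℝ (Fin N) → ℝ) (hfmeas : Measurable f)
    (hfneg : Integrable (fun x => max (-f x) 0) volume)
    (E₁ E₂ : Set (EuclideanSpace ℝ (Fin N)))
    (hE₁ : MeasurableSet E₁) (hE₂ : MeasurableSet E₂)
    (hE₁min : ∀ F, MeasurableSet F → ene J f E₁ ≤ ene J f F)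
    (hE₂min : ∀ F, MeasurableSet F → ene J f E₂ ≤ ene J f F) :
    (∀ F, MeasurableSet F → ene J f (E₁ ∪ E₂) ≤ ene J f F) ∧
    (∀ F, MeasurableSet F → ene J f (E₁ ∩ E₂) ≤ ene J f F) := by
  have hq (F : Set (EuclideanSpace ℝ (Fin N))) :
      ∫⁻ x in F, ENNReal.ofReal (-f x) ≠ ∞ := by
    refine ne_top_of_le_ne_top hfneg.lintegral_lt_top.ne ((setLIntegral_le_lintegral F _).trans ?_)
    exact lintegral_mono fun x => ENNReal.ofReal_le_ofReal (le_max_left _ _)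
  have key (A B : Set (EuclideanSpace ℝ (Fin N))) : ene J f A ≤ ene J f B ↔
      (J A + ∫⁻ x in A, ENNReal.ofReal (f x)) + ∫⁻ x in B, ENNReal.ofReal (-f x) ≤
        (J B + ∫⁻ x in B, ENNReal.ofReal (f x)) + ∫⁻ x in A, ENNReal.ofReal (-f x) := by
    rw [← EReal.coe_ennreal_sub_le_sub_iff (hq A) (hq B)]
    simp only [ene, enInt, EReal.coe_ennreal_add, sub_eq_add_neg, add_assoc]
  have hP : (J (E₁ ∪ E₂) + ∫⁻ x in E₁ ∪ E₂, ENNReal.ofReal (f x)) +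
      (J (E₁ ∩ E₂) + ∫⁻ x in E₁ ∩ E₂, ENNReal.ofReal (f x)) ≤
      (J E₁ + ∫⁻ x in E₁, ENNReal.ofReal (f x)) +
        (J E₂ + ∫⁻ x in E₂, ENNReal.ofReal (f x)) := by
    rw [add_add_add_comm, setLIntegral_union_add_inter _ hE₁ hE₂, add_add_add_comm (J E₁)]
    gcongr ?_ + _
    exact hJsub E₁ E₂ hE₁ hE₂
  have hqmod := setLIntegral_union_add_inter (μ := volume)
    (fun x => ENNReal.ofReal (-f x)) hE₁ hE₂
  simp only [key] at hE₁min hE₂min ⊢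
  constructor <;> intro F hF
  · exact ENNReal.add_le_add_of_submodular (hq _) (hq _) (hq _) (hq _) (hq _) hP hqmod
      (hE₁min F hF) (hE₂min F hF) (hE₂min _ (hE₁.inter hE₂))
  · rw [add_comm] at hqmod
    rw [add_comm (J (E₁ ∪ E₂) + _)] at hP
    exact ENNReal.add_le_add_of_submodular (hq _) (hq _) (hq _) (hq _) (hq _) hP hqmod
      (hE₁min F hF) (hE₂min F hF) (hE₂min _ (hE₁.union hE₂))
end

section
/- Let N ≥ 1 and let J be a submodular set function on the Lebesgue-measurable subsets of ℝ^N with values in [0, +∞]. Let E ⊆ E' be nonempty bounded subsets of ℝ^N and let h > 0. If F is a minimal minimizer of G ↦ J(G) + (1/h)∫_G d_E dx and F' is a minimal minimizer of G ↦ J(G) + (1/h)∫_G d_{E'} dx over Lebesgue-measurable sets, then |F \ F'| = 0. The same conclusion holds when F and F' are the respective maximal minimizers. -/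
open MeasureTheory Filter Set
open scoped ENNReal

theorem ene_of_integrableOn {N : ℕ} {J : Set (EuclideanSpace ℝ (Fin N)) → ℝ≥0∞}
    {f : EuclideanSpace ℝ (Fin N) → ℝ} {G : Set (EuclideanSpace ℝ (Fin N))}
    (hJ : J G ≠ ⊤) (hf : IntegrableOn f G) :
    ene J f G = (((J G).toReal + ∫ x in G, f x : ℝ) : EReal) := by
  have hpos : ∫⁻ x in G, ENNReal.ofReal (f x) ≠ ⊤ := hf.lintegral_lt_top.ne
  have hneg : ∫⁻ x in G, ENNReal.ofReal (-f x) ≠ ⊤ := hf.neg.lintegral_lt_top.ne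
  rw [ene, enInt, integral_eq_lintegral_pos_part_sub_lintegral_neg_part hf,
    EReal.coe_add, EReal.coe_sub, EReal.coe_ennreal_toReal hJ,
    EReal.coe_ennreal_toReal hpos, EReal.coe_ennreal_toReal hneg]

theorem integrableOn_of_lintegral_ne_top {N : ℕ} {f : EuclideanSpace ℝ (Fin N) → ℝ}
    {G : Set (EuclideanSpace ℝ (Fin N))} (hf : Measurable f)
    (hpos : ∫⁻ x in G, ENNReal.ofReal (f x) ≠ ⊤) (hneg : ∫⁻ x in G, ENNReal.ofReal (-f x) ≠ ⊤) :
    IntegrableOn f G := by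
  refine ⟨hf.aestronglyMeasurable, ?_⟩
  rw [hasFiniteIntegral_iff_norm]
  calc ∫⁻ x in G, ENNReal.ofReal ‖f x‖
      ≤ ∫⁻ x in G, (ENNReal.ofReal (f x) + ENNReal.ofReal (-f x)) := by
        refine lintegral_mono fun x => ?_
        rcases abs_choice (f x) with hx | hx <;> simp [Real.norm_eq_abs, hx]
    _ = _ := lintegral_add_left hf.ennreal_ofReal _
    _ < ⊤ := ENNReal.add_lt_top.2 ⟨hpos.lt_top, hneg.lt_top⟩

theorem integrableOn_of_le {N : ℕ} {f g : EuclideanSpace ℝ (Fin N) → ℝ}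
    {G : Set (EuclideanSpace ℝ (Fin N))} (hg : Measurable g) (hgf : g ≤ f)
    (hneg : ∫⁻ x, ENNReal.ofReal (-g x) ≠ ⊤) (hf : IntegrableOn f G) : IntegrableOn g G :=
  integrableOn_of_lintegral_ne_top hg
    (ne_top_of_le_ne_top hf.lintegral_lt_top.ne
      (lintegral_mono fun x => ENNReal.ofReal_le_ofReal (hgf x)))
    (ne_top_of_le_ne_top hneg (setLIntegral_le_lintegral _ _))

theorem ne_top_and_integrableOn_of_ene_ne_top {N : ℕ}
    {J : Set (EuclideanSpace ℝ (Fin N)) → ℝ≥0∞}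
    {f : EuclideanSpace ℝ (Fin N) → ℝ} {G : Set (EuclideanSpace ℝ (Fin N))}
    (hf : Measurable f) (hneg : ∫⁻ x, ENNReal.ofReal (-f x) ≠ ⊤)
    (h : ene J f G ≠ ⊤) : J G ≠ ⊤ ∧ IntegrableOn f G := by
  have hnegG : ∫⁻ x in G, ENNReal.ofReal (-f x) ≠ ⊤ :=
    ne_top_of_le_ne_top hneg (setLIntegral_le_lintegral _ _)
  rw [ene, enInt] at h
  have hposG : ∫⁻ x in G, ENNReal.ofReal (f x) ≠ ⊤ := by
    intro hp
    rw [hp, ← EReal.coe_ennreal_toReal hnegG, EReal.coe_ennreal_top, EReal.top_sub_coe] at h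
    exact h (EReal.add_top_of_ne_bot (EReal.coe_ennreal_ne_bot _))
  refine ⟨fun hJ => ?_, integrableOn_of_lintegral_ne_top hf hposG hnegG⟩
  rw [hJ, ← EReal.coe_ennreal_toReal hnegG, ← EReal.coe_ennreal_toReal hposG,
    ← EReal.coe_sub, EReal.coe_ennreal_top, EReal.top_add_coe] at h
  exact h rfl

/-- If `g ≤ f`, then the intersection of a minimizer for `f` with a minimizer for `g` is again a
minimizer for `f`, and their union is again a minimizer for `g`. -/
theorem isMinimizer_inter_and_union {N : ℕ} {J : Set (EuclideanSpace ℝ (Fin N)) → ℝ≥0∞}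
    (hJ : ∀ A B, MeasurableSet A → MeasurableSet B → J (A ∪ B) + J (A ∩ B) ≤ J A + J B)
    {f g : EuclideanSpace ℝ (Fin N) → ℝ} {F F' : Set (EuclideanSpace ℝ (Fin N))}
    (hgf : g ≤ f) (hJF : J F ≠ ⊤) (hJF' : J F' ≠ ⊤) (hfF : IntegrableOn f F)
    (hgF : IntegrableOn g F) (hgF' : IntegrableOn g F')
    (hF : IsMinimizer (ene J f) F) (hF' : IsMinimizer (ene J g) F') :
    IsMinimizer (ene J f) (F ∩ F') ∧ IsMinimizer (ene J g) (F ∪ F') := by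
  have hsub := hJ F F' hF.1 hF'.1
  have hfin := ENNReal.add_ne_top.2 ⟨hJF, hJF'⟩
  obtain ⟨hJu, hJi⟩ := ENNReal.add_ne_top.1 (ne_top_of_le_ne_top hfin hsub)
  have hsubR := ENNReal.toReal_mono hfin hsub
  rw [ENNReal.toReal_add hJu hJi, ENNReal.toReal_add hJF hJF'] at hsubR
  have hfi : IntegrableOn f (F ∩ F') := hfF.mono_set inter_subset_left
  have hgi : IntegrableOn g (F ∩ F') := hgF.mono_set inter_subset_left
  have hgu : IntegrableOn g (F ∪ F') := hgF.union hgF'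
  have hadd : (∫ x in F ∪ F', g x) + ∫ x in F ∩ F', g x =
      (∫ x in F, g x) + ∫ x in F', g x := by
    rw [← union_sdiff_self, setIntegral_union disjoint_sdiff_right (hF'.1.diff hF.1) hgF
      (hgF'.mono_set sdiff_subset), ← integral_inter_add_sdiff hF.1 hgF', inter_comm F' F]
    ring
  have hdiff : ∫ x in F ∩ F', (f x - g x) ≤ ∫ x in F, (f x - g x) :=
    setIntegral_mono_set (hfF.sub hgF) (ae_of_all _ fun x => sub_nonneg.2 (hgf x))
      (LE.le.eventuallyLE inter_subset_left)
  rw [integral_sub hfi hgi, integral_sub hfF hgF] at hdiff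
  have h₁ := hF.2 _ (hF.1.inter hF'.1)
  have h₂ := hF'.2 _ (hF.1.union hF'.1)
  rw [ene_of_integrableOn hJF hfF, ene_of_integrableOn hJi hfi, EReal.coe_le_coe_iff] at h₁
  rw [ene_of_integrableOn hJF' hgF', ene_of_integrableOn hJu hgu, EReal.coe_le_coe_iff] at h₂
  constructor
  · refine ⟨hF.1.inter hF'.1, fun G hG => le_trans ?_ (hF.2 G hG)⟩
    rw [ene_of_integrableOn hJF hfF, ene_of_integrableOn hJi hfi, EReal.coe_le_coe_iff]
    linarith
  · refine ⟨hF.1.union hF'.1, fun G hG => le_trans ?_ (hF'.2 G hG)⟩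
    rw [ene_of_integrableOn hJF' hgF', ene_of_integrableOn hJu hgu, EReal.coe_le_coe_iff]
    linarith

/-- Either both energies are identically `⊤`, so that every measurable set minimizes both of them,
or intersection and union of the two minimizers are again minimizers. -/
theorem isMinimizer_all_or_inter_and_union {N : ℕ} {J : Set (EuclideanSpace ℝ (Fin N)) → ℝ≥0∞}
    (hJ : ∀ A B, MeasurableSet A → MeasurableSet B → J (A ∪ B) + J (A ∩ B) ≤ J A + J B)
    {f g : EuclideanSpace ℝ (Fin N) → ℝ} (hf : Measurable f) (hg : Measurable g)
    (hgf : g ≤ f) (hfneg : ∫⁻ x, ENNReal.ofReal (-f x) ≠ ⊤)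
    (hgneg : ∫⁻ x, ENNReal.ofReal (-g x) ≠ ⊤)
    (hint : ∀ G, IntegrableOn g G → IntegrableOn f G)
    {F F' : Set (EuclideanSpace ℝ (Fin N))}
    (hF : IsMinimizer (ene J f) F) (hF' : IsMinimizer (ene J g) F') :
    (∀ G, MeasurableSet G → IsMinimizer (ene J f) G ∧ IsMinimizer (ene J g) G) ∨
      (IsMinimizer (ene J f) (F ∩ F') ∧ IsMinimizer (ene J g) (F ∪ F')) := by
  by_cases hall : ∀ G, MeasurableSet G → ene J f G = ⊤
  · left
    have hall' : ∀ G, MeasurableSet G → ene J g G = ⊤ := by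
      intro G hG
      by_contra hne
      obtain ⟨hJG, hgG⟩ := ne_top_and_integrableOn_of_ene_ne_top hg hgneg hne
      have := hall G hG
      rw [ene_of_integrableOn hJG (hint G hgG)] at this
      exact EReal.coe_ne_top _ this
    exact fun G hG => ⟨⟨hG, fun K hK => (hall K hK).symm ▸ le_top⟩,
      ⟨hG, fun K hK => (hall' K hK).symm ▸ le_top⟩⟩
  · right
    push Not at hall
    obtain ⟨G, hG, hne⟩ := hall
    obtain ⟨hJG, hfG⟩ := ne_top_and_integrableOn_of_ene_ne_top hf hfneg hne
    have hne' : ene J g G ≠ ⊤ := by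
      rw [ene_of_integrableOn hJG (integrableOn_of_le hg hgf hgneg hfG)]
      exact EReal.coe_ne_top _
    obtain ⟨hJF, hfF⟩ := ne_top_and_integrableOn_of_ene_ne_top hf hfneg
      (ne_top_of_le_ne_top hne (hF.2 G hG))
    obtain ⟨hJF', hgF'⟩ := ne_top_and_integrableOn_of_ene_ne_top hg hgneg
      (ne_top_of_le_ne_top hne' (hF'.2 G hG))
    exact isMinimizer_inter_and_union hJ hgf hJF hJF' hfF
      (integrableOn_of_le hg hgf hgneg hfF) hgF' hF hF'

theorem sdist_of_notMem {N : ℕ} {E : Set (EuclideanSpace ℝ (Fin N))}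
    {x : EuclideanSpace ℝ (Fin N)} (hx : x ∉ E) : sdist E x = Metric.infDist x E := by
  rw [sdist, Metric.infDist_zero_of_mem (mem_compl hx), sub_zero]

theorem sdist_anti {N : ℕ} {E E' : Set (EuclideanSpace ℝ (Fin N))} (hE : E.Nonempty)
    (hE' : E'ᶜ.Nonempty) (h : E ⊆ E') (x : EuclideanSpace ℝ (Fin N)) :
    sdist E' x ≤ sdist E x :=
  sub_le_sub (Metric.infDist_le_infDist_of_subset h hE)
    (Metric.infDist_le_infDist_of_subset (compl_subset_compl.2 h) hE')

theorem lintegral_neg_sdist_ne_top {N : ℕ} {E : Set (EuclideanSpace ℝ (Fin N))}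
    (hE : Bornology.IsBounded E) : ∫⁻ x, ENNReal.ofReal (-sdist E x) ≠ ⊤ := by
  have hint : Integrable (fun x => max (-sdist E x) 0) := by
    refine ((continuous_sdist E).neg.max continuous_const).integrable_of_hasCompactSupport ?_
    refine HasCompactSupport.intro hE.isCompact_closure fun x hx => max_eq_right ?_
    change -sdist E x ≤ 0
    rw [sdist_of_notMem fun h => hx (subset_closure h)]
    exact neg_nonpos.2 Metric.infDist_nonneg
  simpa [ENNReal.ofReal_max] using hint.lintegral_lt_top.ne

theorem integrableOn_sdist_of_subset {N : ℕ} {E E' : Set (EuclideanSpace ℝ (Fin N))}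
    (hE : E.Nonempty) (hE' : Bornology.IsBounded E') (h : E ⊆ E')
    {G : Set (EuclideanSpace ℝ (Fin N))} (hG : IntegrableOn (sdist E') G) :
    IntegrableOn (sdist E) G := by
  obtain ⟨e, he⟩ := hE
  obtain ⟨r, hr⟩ := hE'.subset_closedBall e
  have hr0 : 0 ≤ r := dist_nonneg.trans (hr (h he))
  set B := Metric.closedBall e (2 * r)
  have hin : IntegrableOn (sdist E) (G ∩ B) :=
    ((continuous_sdist E).continuousOn.integrableOn_compact
      (isCompact_closedBall e (2 * r))).mono_set inter_subset_right
  have hout : IntegrableOn (sdist E) (G \ B) := by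
    have hB : ∀ᵐ x ∂volume.restrict (G \ B), x ∈ Bᶜ :=
      ae_mono (Measure.restrict_mono (sdiff_subset_compl _ _) le_rfl)
        (ae_restrict_mem Metric.isClosed_closedBall.measurableSet.compl)
    refine ((hG.mono_set sdiff_subset).const_mul 2).mono'
      (continuous_sdist E).aestronglyMeasurable (hB.mono fun x hx => ?_)
    have hx' : 2 * r < dist x e := not_le.1 hx
    have hxE' : x ∉ E' := fun hxE => by
      have : dist x e ≤ r := hr hxE
      linarith
    rw [sdist_of_notMem hxE', sdist_of_notMem fun hxE => hxE' (h hxE), Real.norm_eq_abs,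
      abs_of_nonneg Metric.infDist_nonneg]
    have hlow : dist x e - r ≤ Metric.infDist x E' :=
      (Metric.le_infDist ⟨e, h he⟩).2 fun y hy => by
        have : dist y e ≤ r := hr hy
        linarith [dist_triangle x y e]
    linarith [Metric.infDist_le_dist_of_mem (x := x) he]
  rw [← inter_union_sdiff G B]
  exact hin.union hout

/-- **comparison principle for the discrete scheme.** If `E ⊆ E'` are
nonempty bounded sets, the minimal (resp. maximal) minimizer of
`G ↦ J(G) + (1/h)∫_G d_E dx` is contained, up to a null set, in the minimal
(resp. maximal) minimizer of `G ↦ J(G) + (1/h)∫_G d_{E'} dx`. -/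
theorem stmt6 (N : ℕ) (hN : 1 ≤ N)
    (J : Set (EuclideanSpace ℝ (Fin N)) → ℝ≥0∞)
    (hJsub : ∀ A B : Set (EuclideanSpace ℝ (Fin N)), MeasurableSet A → MeasurableSet B →
      J (A ∪ B) + J (A ∩ B) ≤ J A + J B)
    (E E' : Set (EuclideanSpace ℝ (Fin N)))
    (hEne : E.Nonempty) (hE'ne : E'.Nonempty)
    (hEbd : Bornology.IsBounded E) (hE'bd : Bornology.IsBounded E')
    (hEE' : E ⊆ E')
    (h : ℝ) (hh : 0 < h) :
    (∀ F F' : Set (EuclideanSpace ℝ (Fin N)),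
      IsMinimalMinimizer (ene J (fun x => sdist E x / h)) F →
      IsMinimalMinimizer (ene J (fun x => sdist E' x / h)) F' →
      volume (F \ F') = 0) ∧
    (∀ F F' : Set (EuclideanSpace ℝ (Fin N)),
      IsMaximalMinimizer (ene J (fun x => sdist E x / h)) F →
      IsMaximalMinimizer (ene J (fun x => sdist E' x / h)) F' →
      volume (F \ F') = 0) := by
  have hh' : 0 < h⁻¹ := inv_pos.2 hh
  have : Nonempty (Fin N) := ⟨⟨0, hN⟩⟩
  have hE'c : E'ᶜ.Nonempty := by
    rw [nonempty_compl]
    rintro rfl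
    exact NormedSpace.unbounded_univ ℝ _ hE'bd
  have hneg : ∀ A : Set (EuclideanSpace ℝ (Fin N)), Bornology.IsBounded A →
      ∫⁻ x, ENNReal.ofReal (-(sdist A x / h)) ≠ ⊤ := fun A hA => by
    simp_rw [div_eq_inv_mul, ← mul_neg, ENNReal.ofReal_mul hh'.le]
    rw [lintegral_const_mul' _ _ ENNReal.ofReal_ne_top]
    exact ENNReal.mul_ne_top ENNReal.ofReal_ne_top (lintegral_neg_sdist_ne_top hA)
  have hmeas : ∀ A : Set (EuclideanSpace ℝ (Fin N)), Measurable fun x => sdist A x / h :=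
    fun A => (continuous_sdist A).measurable.div_const h
  have hscale : ∀ A G : Set (EuclideanSpace ℝ (Fin N)),
      IntegrableOn (fun x => sdist A x / h) G ↔ IntegrableOn (sdist A) G := fun A G => by
    simp_rw [div_eq_mul_inv]
    exact integrable_mul_const_iff (isUnit_iff_ne_zero.2 hh'.ne') _
  have hcomp := fun F F' => isMinimizer_all_or_inter_and_union (F := F) (F' := F') hJsub
    (hmeas E) (hmeas E')
    (fun x => div_le_div_of_nonneg_right (sdist_anti hEne hE'c hEE' x) hh.le)
    (hneg E hEbd) (hneg E' hE'bd) fun G => by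
      rw [hscale, hscale]
      exact integrableOn_sdist_of_subset hEne hE'bd hEE'
  refine ⟨fun F F' hF hF' => ?_, fun F F' hF hF' => ?_⟩
  · rcases hcomp F F' hF.1 hF'.1 with hall | ⟨hi, -⟩
    · exact measure_mono_null (by simp) (hF.2 ∅ (hall ∅ .empty).1)
    · simpa using hF.2 _ hi
  · rcases hcomp F F' hF.1 hF'.1 with hall | ⟨-, hu⟩
    · exact measure_mono_null (sdiff_subset_sdiff_left (subset_univ F))
        (hF'.2 univ (hall univ .univ).2)
    · simpa using hF'.2 _ hu
end

section
/- Let N ≥ 1. There exists a constant C > 1 depending only on N with the following property. Let J be a set function on the Lebesgue-measurable subsets of ℝ^N with values in [0, +∞] which is submodular, translation invariant, insensitive to null sets, and satisfies J(∅) = 0. Let R, h > 0 and for r > 0 consider the functional 𝓔_r(F) := J(F) + (1/h)∫_F (|x| − r) dx over Lebesgue-measurable sets F (note that d_{B_r}(x) = |x| − r). If F_R is a minimal minimizer of 𝓔_R and 𝓔_{2R} admits a minimal minimizer, then |F_R \ B_{CR}| = 0. The same holds with 'minimal' replaced by 'maximal' throughout. -/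
open MeasureTheory Filter Set
open scoped ENNReal

open Metric

section Comparison

variable {N : ℕ} {J : Set (EuclideanSpace ℝ (Fin N)) → ℝ≥0∞}
  {f g : EuclideanSpace ℝ (Fin N) → ℝ} {E F G : Set (EuclideanSpace ℝ (Fin N))}

/-- An inequality between energies, rewritten without subtraction. -/
lemma add_le_add_of_ene_le (hf : ∫⁻ x, ENNReal.ofReal (-f x) ≠ ∞)
    (h : ene J f F ≤ ene J f G) :
    J F + (∫⁻ x in F, ENNReal.ofReal (f x)) + ∫⁻ x in G, ENNReal.ofReal (-f x) ≤
      J G + (∫⁻ x in G, ENNReal.ofReal (f x)) + ∫⁻ x in F, ENNReal.ofReal (-f x) := by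
  have hF : ∫⁻ x in F, ENNReal.ofReal (-f x) ≠ ∞ :=
    ne_top_of_le_ne_top hf (setLIntegral_le_lintegral _ _)
  have hG : ∫⁻ x in G, ENNReal.ofReal (-f x) ≠ ∞ :=
    ne_top_of_le_ne_top hf (setLIntegral_le_lintegral _ _)
  unfold ene enInt at h
  generalize (∫⁻ x in F, ENNReal.ofReal (-f x)) = a at *
  generalize (∫⁻ x in G, ENNReal.ofReal (-f x)) = b at *
  generalize (∫⁻ x in F, ENNReal.ofReal (f x)) = c at *
  generalize (∫⁻ x in G, ENNReal.ofReal (f x)) = d at *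
  lift a to NNReal using hF
  lift b to NNReal using hG
  rw [← EReal.coe_ennreal_le_coe_ennreal_iff]
  push_cast
  have key : ∀ u : ℝ≥0∞, ∀ v : ℝ≥0∞, ∀ w : NNReal,
      ((u : EReal) + ((v : EReal) - ((w : ℝ≥0∞) : EReal))) + ((w : ℝ≥0∞) : EReal)
        = u + v := by
    intro u v w
    rw [add_assoc]
    congr 1
    exact EReal.sub_add_cancel
  have h' := add_le_add_left h (((a : ℝ≥0∞) : EReal) + ((b : ℝ≥0∞) : EReal))
  rw [← add_assoc, key, add_comm ((a : ℝ≥0∞) : EReal), ← add_assoc, key] at h'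
  exact h'

lemma IsMinimizer.add_lintegral_le (hF : IsMinimizer (ene J f) F) (hJ : J ∅ = 0)
    (hf : ∫⁻ x, ENNReal.ofReal (-f x) ≠ ∞) :
    J F + (∫⁻ x in F, ENNReal.ofReal (f x)) ≤ ∫⁻ x in F, ENNReal.ofReal (-f x) := by
  simpa [hJ] using add_le_add_of_ene_le hf (hF.2 ∅ MeasurableSet.empty)

/-- Strict comparison principle: minimizers are ordered reversely to their forcing terms. -/
lemma IsMinimizer.volume_diff_eq_zero
    (hsub : ∀ A B : Set (EuclideanSpace ℝ (Fin N)), MeasurableSet A → MeasurableSet B →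
      J (A ∪ B) + J (A ∩ B) ≤ J A + J B)
    (hJ : J ∅ = 0) (hfm : Measurable f) (hgm : Measurable g) (hgf : ∀ x, g x < f x)
    (hf : ∫⁻ x, ENNReal.ofReal (-f x) ≠ ∞) (hg : ∫⁻ x, ENNReal.ofReal (-g x) ≠ ∞)
    (hE : IsMinimizer (ene J f) E) (hF : IsMinimizer (ene J g) F) :
    volume (E \ F) = 0 := by
  have hfs : ∀ s, ∫⁻ x in s, ENNReal.ofReal (-f x) ≠ ∞ := fun s =>
    ne_top_of_le_ne_top hf (setLIntegral_le_lintegral _ _)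
  have hgs : ∀ s, ∫⁻ x in s, ENNReal.ofReal (-g x) ≠ ∞ := fun s =>
    ne_top_of_le_ne_top hg (setLIntegral_le_lintegral _ _)
  have hEfin := ne_top_of_le_ne_top (hfs E) (hE.add_lintegral_le hJ hf)
  have hFfin := ne_top_of_le_ne_top (hgs F) (hF.add_lintegral_le hJ hg)
  have h₁ := add_le_add_of_ene_le hf (hE.2 (E ∩ F) (hE.1.inter hF.1))
  have h₂ := add_le_add_of_ene_le hg (hF.2 (E ∪ F) (hE.1.union hF.1))
  have hJs := hsub E F hE.1 hF.1
  have hD : MeasurableSet (E \ F) := hE.1.diff hF.1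
  have split₁ : ∀ u : EuclideanSpace ℝ (Fin N) → ℝ≥0∞,
      ∫⁻ x in E, u x = (∫⁻ x in E ∩ F, u x) + ∫⁻ x in E \ F, u x := fun u =>
    (lintegral_inter_add_sdiff u E hF.1).symm
  have split₂ : ∀ u : EuclideanSpace ℝ (Fin N) → ℝ≥0∞,
      ∫⁻ x in E ∪ F, u x = (∫⁻ x in F, u x) + ∫⁻ x in E \ F, u x := fun u => by
    rw [← sdiff_union_self, lintegral_union hF.1 disjoint_sdiff_left, add_comm]
  rw [split₁, split₁] at h₁
  rw [split₂, split₂] at h₂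
  rw [split₁] at hEfin
  have hP : ∫⁻ x in E \ F, ENNReal.ofReal (g x) ≤ ∫⁻ x in E \ F, ENNReal.ofReal (f x) :=
    lintegral_mono fun x => ENNReal.ofReal_le_ofReal (hgf x).le
  have a₁ := hfs (E ∩ F)
  have a₂ := hfs (E \ F)
  have a₃ := hgs F
  have a₄ := hgs (E \ F)
  have hlt : (volume (E \ F) ≠ 0) →
      (∫⁻ x in E \ F, ENNReal.ofReal (g x)) + (∫⁻ x in E \ F, ENNReal.ofReal (-f x)) <
      (∫⁻ x in E \ F, ENNReal.ofReal (f x)) + (∫⁻ x in E \ F, ENNReal.ofReal (-g x)) := by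
    intro h0
    rw [← lintegral_add_left (by fun_prop), ← lintegral_add_left (by fun_prop)]
    refine setLIntegral_strict_mono hD h0 (by fun_prop) ?_ (ae_of_all _ fun x _ => ?_)
    · rw [lintegral_add_left (by fun_prop)]
      simp only [ne_eq, ENNReal.add_eq_top, not_or] at hEfin ⊢
      exact ⟨ne_top_of_le_ne_top hEfin.2.2 hP, a₂⟩
    · have hx := hgf x
      rcases le_or_gt (f x) 0 with h | h
      · rw [ENNReal.ofReal_of_nonpos h, ENNReal.ofReal_of_nonpos (hx.le.trans h), zero_add,
          zero_add]
        exact (ENNReal.ofReal_lt_ofReal_iff (by linarith)).2 (by linarith)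
      · rw [ENNReal.ofReal_of_nonpos (show -f x ≤ 0 by linarith), add_zero]
        exact ((ENNReal.ofReal_lt_ofReal_iff h).2 hx).trans_le le_self_add
  by_contra h0
  have hlt := hlt h0
  simp only [ne_eq, ENNReal.add_eq_top, not_or] at hEfin hFfin
  obtain ⟨e₁, e₂, e₃⟩ := hEfin
  obtain ⟨e₄, e₅⟩ := hFfin
  have e₆ := ne_top_of_le_ne_top e₃ hP
  have e₇ : J (E ∪ F) + J (E ∩ F) ≠ ∞ := ne_top_of_le_ne_top (by simp [e₁, e₄]) hJs
  simp only [ne_eq, ENNReal.add_eq_top, not_or] at e₇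
  obtain ⟨e₇, e₈⟩ := e₇
  generalize (∫⁻ x in E \ F, ENNReal.ofReal (f x)) = p₁ at *
  generalize (∫⁻ x in E \ F, ENNReal.ofReal (g x)) = p₂ at *
  generalize (∫⁻ x in E \ F, ENNReal.ofReal (-f x)) = p₃ at *
  generalize (∫⁻ x in E \ F, ENNReal.ofReal (-g x)) = p₄ at *
  generalize (∫⁻ x in E ∩ F, ENNReal.ofReal (f x)) = p₅ at *
  generalize (∫⁻ x in E ∩ F, ENNReal.ofReal (-f x)) = p₆ at *
  generalize (∫⁻ x in F, ENNReal.ofReal (g x)) = p₇ at *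
  generalize (∫⁻ x in F, ENNReal.ofReal (-g x)) = p₈ at *
  generalize J E = j₁ at *
  generalize J F = j₂ at *
  generalize J (E ∪ F) = j₃ at *
  generalize J (E ∩ F) = j₄ at *
  lift p₁ to NNReal using e₃
  lift p₂ to NNReal using e₆
  lift p₃ to NNReal using a₂
  lift p₄ to NNReal using a₄
  lift p₅ to NNReal using e₂
  lift p₆ to NNReal using a₁
  lift p₇ to NNReal using e₅
  lift p₈ to NNReal using a₃
  lift j₁ to NNReal using e₁
  lift j₂ to NNReal using e₄
  lift j₃ to NNReal using e₇
  lift j₄ to NNReal using e₈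
  norm_cast at *
  simp only [← NNReal.coe_le_coe, ← NNReal.coe_lt_coe, NNReal.coe_add] at *
  linarith

lemma enInt_image_add_right (y : EuclideanSpace ℝ (Fin N)) :
    enInt (fun x => f (x - y)) ((fun x => x + y) '' F) = enInt f F := by
  have key : ∀ u : EuclideanSpace ℝ (Fin N) → ℝ≥0∞,
      ∫⁻ x in (fun x => x + y) '' F, u (x - y) = ∫⁻ x in F, u x := fun u => by
    have := (measurePreserving_add_right
      (volume : Measure (EuclideanSpace ℝ (Fin N))) y).setLIntegral_comp_emb
        (MeasurableEquiv.addRight y).measurableEmbedding (fun x => u (x - y)) F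
    simpa using this.symm
  unfold enInt
  rw [key fun x => ENNReal.ofReal (f x), key fun x => ENNReal.ofReal (-f x)]

lemma IsMinimizer.image_add_right
    (htr : ∀ (A : Set (EuclideanSpace ℝ (Fin N))) (y : EuclideanSpace ℝ (Fin N)),
      J ((fun x => x + y) '' A) = J A)
    (hF : IsMinimizer (ene J f) F) (y : EuclideanSpace ℝ (Fin N)) :
    IsMinimizer (ene J fun x => f (x - y)) ((fun x => x + y) '' F) := by
  have htrans : ∀ A, ene J (fun x => f (x - y)) ((fun x => x + y) '' A) = ene J f A := fun A => by
    unfold ene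
    rw [htr, enInt_image_add_right]
  refine ⟨(MeasurableEquiv.addRight y).measurableSet_image.2 hF.1, fun G hG => ?_⟩
  have himg : (fun x => x + y) '' ((fun x => x + y) ⁻¹' G) = G :=
    image_preimage_eq _ (add_right_surjective y)
  rw [htrans, ← himg, htrans]
  exact hF.2 _ ((measurable_add_const y) hG)

/-- If `volume (A + y \ F) = 0` for all `y` in a set `S`, then a.e. point `a ∈ A` has
`a + S ⊆ F` up to a null set. -/
lemma ae_ae_add_mem {A S : Set (EuclideanSpace ℝ (Fin N))} (hA : MeasurableSet A)
    (hS : MeasurableSet S) (hF : MeasurableSet F)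
    (h : ∀ y ∈ S, volume (((fun x => x + y) '' A) \ F) = 0) :
    ∀ᵐ a, a ∈ A → ∀ᵐ y, y ∈ S → a + y ∈ F := by
  have h1 : ∀ᵐ y : EuclideanSpace ℝ (Fin N), ∀ᵐ a : EuclideanSpace ℝ (Fin N),
      y ∈ S → a ∈ A → a + y ∈ F := by
    refine ae_of_all _ fun y => ?_
    by_cases hy : y ∈ S
    · have := (measurePreserving_add_right (volume : Measure (EuclideanSpace ℝ (Fin N)))
        y).quasiMeasurePreserving.preimage_null (h y hy)
      filter_upwards [compl_mem_ae_iff.2 this] with a ha _ haA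
      by_contra haF
      exact ha ⟨⟨a, haA, rfl⟩, haF⟩
    · exact ae_of_all _ fun a h => absurd h hy
  have hmeas : MeasurableSet {p : EuclideanSpace ℝ (Fin N) × EuclideanSpace ℝ (Fin N) |
      p.1 ∈ S → p.2 ∈ A → p.2 + p.1 ∈ F} := by
    have : {p : EuclideanSpace ℝ (Fin N) × EuclideanSpace ℝ (Fin N) |
      p.1 ∈ S → p.2 ∈ A → p.2 + p.1 ∈ F} =
        (Prod.fst ⁻¹' S)ᶜ ∪ ((Prod.snd ⁻¹' A)ᶜ ∪ (fun p => p.2 + p.1) ⁻¹' F) := by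
      ext p
      simp only [mem_ofPred_eq, mem_union, mem_compl_iff, mem_preimage]
      tauto
    rw [this]
    exact (measurable_fst hS).compl.union ((measurable_snd hA).compl.union
      ((measurable_snd.add measurable_fst) hF))
  filter_upwards [(Measure.ae_ae_comm hmeas).1 h1] with a ha haA
  filter_upwards [ha] with y hy hyS using hy hyS haA

lemma lintegral_ofReal_neg_signedDist_le (y : EuclideanSpace ℝ (Fin N)) {r h : ℝ} (hh : 0 < h) :
    ∫⁻ x, ENNReal.ofReal (-((‖x - y‖ - r) / h)) ≤
      ENNReal.ofReal (r / h) * volume (ball y r) := by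
  rw [← lintegral_indicator_const measurableSet_ball]
  refine lintegral_mono fun x => ?_
  by_cases hx : x ∈ ball y r
  · rw [indicator_of_mem hx]
    refine ENNReal.ofReal_le_ofReal ?_
    rw [← neg_div]
    gcongr
    linarith [norm_nonneg (x - y)]
  · rw [indicator_of_notMem hx, ENNReal.ofReal_of_nonpos]
    rw [mem_ball, dist_eq_norm, not_lt] at hx
    exact neg_nonpos.2 (div_nonneg (by linarith) hh.le)

lemma IsMinimizer.volume_diff_ball_eq_zero
    (hsub : ∀ A B : Set (EuclideanSpace ℝ (Fin N)), MeasurableSet A → MeasurableSet B →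
      J (A ∪ B) + J (A ∩ B) ≤ J A + J B)
    (htr : ∀ (A : Set (EuclideanSpace ℝ (Fin N))) (y : EuclideanSpace ℝ (Fin N)),
      J ((fun x => x + y) '' A) = J A)
    (hJ : J ∅ = 0) {R h : ℝ} (hR : 0 < R) (hh : 0 < h)
    (hE : IsMinimizer (ene J fun x => (‖x‖ - R) / h) E)
    (hF : IsMinimizer (ene J fun x => (‖x‖ - 2 * R) / h) F) :
    volume (E \ ball 0 ((2 ^ (N + 1) + 4) * R)) = 0 := by
  have hM : ∀ (y : EuclideanSpace ℝ (Fin N)) (r : ℝ),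
      ∫⁻ x, ENNReal.ofReal (-((‖x - y‖ - r) / h)) ≠ ∞ := fun y r =>
    ne_top_of_le_ne_top (ENNReal.mul_ne_top ENNReal.ofReal_ne_top measure_ball_lt_top.ne)
      (lintegral_ofReal_neg_signedDist_le y hh)
  have hM₂ : ∫⁻ x : EuclideanSpace ℝ (Fin N), ENNReal.ofReal (-((‖x‖ - 2 * R) / h)) ≠ ∞ := by
    simpa using hM 0 (2 * R)
  have hcomp : ∀ y ∈ ball (0 : EuclideanSpace ℝ (Fin N)) R,
      volume (((fun x => x + y) '' E) \ F) = 0 := fun y hy => by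
    refine IsMinimizer.volume_diff_eq_zero hsub hJ (by fun_prop) (by fun_prop) (fun x => ?_)
      (hM y R) hM₂ (hE.image_add_right htr y) hF
    rw [mem_ball_zero_iff] at hy
    have := norm_sub_norm_le x y
    exact div_lt_div_of_pos_right (by linarith) hh
  by_contra h0
  obtain ⟨a, ⟨haE, haR⟩, ha⟩ : ∃ a ∈ E \ ball 0 ((2 ^ (N + 1) + 4) * R),
      ∀ᵐ y, y ∈ ball (0 : EuclideanSpace ℝ (Fin N)) R → a + y ∈ F := by
    by_contra hne
    refine h0 (measure_mono_null (fun a ha => ?_) (ae_iff.1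
      (ae_ae_add_mem hE.1 measurableSet_ball hF.1 hcomp)))
    exact fun hmem => hne ⟨a, ha, hmem ha.1⟩
  have haF : ∀ᵐ x, x ∈ ball a R → x ∈ F := by
    have := (measurePreserving_sub_right (volume : Measure (EuclideanSpace ℝ (Fin N)))
      a).quasiMeasurePreserving.ae ha
    filter_upwards [this] with x hx hxa
    simpa using hx (by simpa [dist_eq_norm] using hxa)
  rw [mem_ball_zero_iff, not_lt] at haR
  have hlow : ENNReal.ofReal ((2 ^ (N + 1) + 1) * R / h) * volume (ball a R) ≤
      ∫⁻ x in F, ENNReal.ofReal ((‖x‖ - 2 * R) / h) := calc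
    _ = ∫⁻ _ in ball a R, ENNReal.ofReal ((2 ^ (N + 1) + 1) * R / h) :=
      (setLIntegral_const _ _).symm
    _ ≤ ∫⁻ x in ball a R, ENNReal.ofReal ((‖x‖ - 2 * R) / h) := by
      refine setLIntegral_mono' measurableSet_ball fun x hx => ENNReal.ofReal_le_ofReal ?_
      rw [mem_ball, dist_eq_norm, norm_sub_rev] at hx
      have := norm_sub_norm_le a x
      gcongr
      linarith
    _ ≤ _ := lintegral_mono_set' haF
  have hup : ∫⁻ x in F, ENNReal.ofReal (-((‖x‖ - 2 * R) / h)) ≤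
      ENNReal.ofReal (2 ^ (N + 1) * R / h) * volume (ball a R) := calc
    _ ≤ ∫⁻ x : EuclideanSpace ℝ (Fin N), ENNReal.ofReal (-((‖x‖ - 2 * R) / h)) :=
      setLIntegral_le_lintegral _ _
    _ ≤ ENNReal.ofReal (2 * R / h) * volume (ball (0 : EuclideanSpace ℝ (Fin N)) (2 * R)) := by
      simpa using lintegral_ofReal_neg_signedDist_le (N := N) 0 (r := 2 * R) hh
    _ = _ := by
      rw [Measure.addHaar_ball_mul_of_pos _ _ two_pos, finrank_euclideanSpace_fin,
        ← mul_assoc, ← ENNReal.ofReal_mul (by positivity), Measure.addHaar_ball_center _ a]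
      ring_nf
  have hmin := hF.add_lintegral_le hJ hM₂
  have hle := hlow.trans ((le_add_self.trans hmin).trans hup)
  rw [ENNReal.mul_le_mul_iff_left (measure_ball_pos _ _ hR).ne' measure_ball_lt_top.ne,
    ENNReal.ofReal_le_ofReal_iff (by positivity), div_le_div_iff_of_pos_right hh] at hle
  linarith

end Comparison

/-- There is a dimensional constant `C > 1` such that for every
generalized perimeter `J` (submodular, translation invariant, null-insensitive,
`J ∅ = 0`) and all `R, h > 0`, the minimal (resp. maximal) minimizer `F_R` of
`𝓔_R(F) = J(F) + (1/h)∫_F (|x| − R) dx` satisfies `|F_R \ B_{CR}| = 0`,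
provided `𝓔_{2R}` admits a minimal (resp. maximal) minimizer. -/
theorem stmt8 (N : ℕ) (hN : 1 ≤ N) :
    ∃ C : ℝ, 1 < C ∧
      ∀ J : Set (EuclideanSpace ℝ (Fin N)) → ℝ≥0∞,
        (∀ A B : Set (EuclideanSpace ℝ (Fin N)), MeasurableSet A → MeasurableSet B →
          J (A ∪ B) + J (A ∩ B) ≤ J A + J B) →
        (∀ (A : Set (EuclideanSpace ℝ (Fin N))) (y : EuclideanSpace ℝ (Fin N)),
          J ((fun x => x + y) '' A) = J A) →
        (∀ A B : Set (EuclideanSpace ℝ (Fin N)), MeasurableSet A → MeasurableSet B →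
          volume (symmDiff A B) = 0 → J A = J B) →
        J ∅ = 0 →
        ∀ R h : ℝ, 0 < R → 0 < h →
          (∀ F_R : Set (EuclideanSpace ℝ (Fin N)),
            IsMinimalMinimizer (ene J (fun x => (‖x‖ - R) / h)) F_R →
            (∃ F₂ : Set (EuclideanSpace ℝ (Fin N)),
              IsMinimalMinimizer (ene J (fun x => (‖x‖ - 2 * R) / h)) F₂) →
            volume (F_R \ Metric.ball (0 : EuclideanSpace ℝ (Fin N)) (C * R)) = 0) ∧
          (∀ F_R : Set (EuclideanSpace ℝ (Fin N)),
            IsMaximalMinimizer (ene J (fun x => (‖x‖ - R) / h)) F_R →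
            (∃ F₂ : Set (EuclideanSpace ℝ (Fin N)),
              IsMaximalMinimizer (ene J (fun x => (‖x‖ - 2 * R) / h)) F₂) →
            volume (F_R \ Metric.ball (0 : EuclideanSpace ℝ (Fin N)) (C * R)) = 0) := by
  refine ⟨2 ^ (N + 1) + 4, by linarith [pow_pos (two_pos : (0 : ℝ) < 2) (N + 1)], ?_⟩
  intro J hsub htr _ hJ R h hR hh
  exact ⟨fun _ hE ⟨_, hF⟩ => hE.1.volume_diff_ball_eq_zero hsub htr hJ hR hh hF.1,
    fun _ hE ⟨_, hF⟩ => hE.1.volume_diff_ball_eq_zero hsub htr hJ hR hh hF.1⟩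
end

section
/- Let N ≥ 1 and let J be a set function on the Lebesgue-measurable subsets of ℝ^N with values in [0, +∞] which is submodular, translation invariant, insensitive to null sets, satisfies J(∅) = 0, and satisfies J(B) < +∞ for every open ball B. Let R, h, M > 0 with M ≥ R, and let F be a minimizer over Lebesgue-measurable sets of 𝓔(G) := J(G) + (1/h)∫_G (|x| − R) dx such that |F \ B_M| = 0. Let m ∈ ℝ be such that κ⁺(x, B(z, ρ)) ≥ m for every open ball B(z, ρ) with 0 < ρ ≤ 2M and every x with |x − z| = ρ. If R − hm > 0, then |F \ \overline{B}_{R−hm}| = 0, where \overline{B}_{R−hm} is the closed ball of radius R − hm centered at the origin. -/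
open MeasureTheory Filter Set
open scoped ENNReal

/-- The lower curvature `κ⁺(x, A)` of a set `A` at a point `x`, relative to the generalized
perimeter `J`: the infimum, over all sequences `(W n)` of measurable sets with
`|W n \ A| > 0` shrinking to `x` (i.e. eventually contained in every ball around `x`),
of `liminf_n (J(A ∪ W n) − J(A)) / |W n \ A|` (here the quotient is realized as a product
with the inverse of the real-valued measure).  Convention: `sInf ∅ = ⊤`. -/
noncomputable def kappaPlus {N : ℕ} (J : Set (EuclideanSpace ℝ (Fin N)) → ℝ≥0∞)
    (x : EuclideanSpace ℝ (Fin N)) (A : Set (EuclideanSpace ℝ (Fin N))) : EReal :=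
  sInf { v : EReal | ∃ W : ℕ → Set (EuclideanSpace ℝ (Fin N)),
    (∀ n, MeasurableSet (W n)) ∧ (∀ n, 0 < volume (W n \ A)) ∧
    (∀ ε > (0:ℝ), ∀ᶠ n in atTop, W n ⊆ Metric.closedBall x ε) ∧
    v = liminf (fun n =>
      ((J (A ∪ W n) : EReal) - (J A : EReal)) * (((volume (W n \ A)).toReal)⁻¹ : ℝ))
      atTop }

lemma enInt_eq_setIntegral {N : ℕ} {f : EuclideanSpace ℝ (Fin N) → ℝ}
    {F : Set (EuclideanSpace ℝ (Fin N))} (hf : IntegrableOn f F) :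
    enInt f F = ((∫ x in F, f x : ℝ) : EReal) := by
  have hfin (g : EuclideanSpace ℝ (Fin N) → ℝ) (hg : IntegrableOn g F) :
      ∫⁻ x in F, ENNReal.ofReal (g x) ≠ ⊤ :=
    ne_top_of_le_ne_top hg.2.ne (lintegral_mono fun x => Real.ofReal_le_enorm (g x))
  rw [integral_eq_lintegral_pos_part_sub_lintegral_neg_part hf, EReal.coe_sub, enInt,
    EReal.coe_ennreal_toReal (hfin f hf), EReal.coe_ennreal_toReal (hfin (fun x => -f x) hf.neg)]

lemma ene_congr {N : ℕ} {J : Set (EuclideanSpace ℝ (Fin N)) → ℝ≥0∞}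
    {f : EuclideanSpace ℝ (Fin N) → ℝ} {A B : Set (EuclideanSpace ℝ (Fin N))}
    (hJ : J A = J B) (hAB : A =ᵐ[volume] B) : ene J f A = ene J f B := by
  simp only [ene, enInt, hJ, Measure.restrict_congr_set hAB]

/-- Adding a minimizer `F` to a competitor `B` increases `J` by at most minus the energy of
`F \ B`. -/
lemma toReal_union_sub_le_of_minimizer {N : ℕ} {J : Set (EuclideanSpace ℝ (Fin N)) → ℝ≥0∞}
    (hJsub : ∀ A B : Set (EuclideanSpace ℝ (Fin N)), MeasurableSet A → MeasurableSet B →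
      J (A ∪ B) + J (A ∩ B) ≤ J A + J B)
    {f : EuclideanSpace ℝ (Fin N) → ℝ} {F B : Set (EuclideanSpace ℝ (Fin N))}
    (hF : MeasurableSet F) (hB : MeasurableSet B) (hJF : J F ≠ ⊤) (hJB : J B ≠ ⊤)
    (hf : IntegrableOn f F) (hvol : volume (F \ B) ≠ ⊤)
    (hmin : ∀ G, MeasurableSet G → ene J f F ≤ ene J f G)
    {c : ℝ} (hc : ∀ x ∈ F \ B, c ≤ f x) :
    J (F ∪ B) ≠ ⊤ ∧
      (J (F ∪ B)).toReal - (J B).toReal ≤ -c * (volume (F \ B)).toReal := by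
  have hsub := hJsub F B hF hB
  have hsum : J F + J B ≠ ⊤ := ENNReal.add_ne_top.2 ⟨hJF, hJB⟩
  obtain ⟨hU, hI⟩ := ENNReal.add_ne_top.1 (ne_top_of_le_ne_top hsum hsub)
  refine ⟨hU, ?_⟩
  have hsub' := ENNReal.toReal_mono hsum hsub
  rw [ENNReal.toReal_add hU hI, ENNReal.toReal_add hJF hJB] at hsub'
  have hE := hmin (F ∩ B) (hF.inter hB)
  rw [ene, ene, enInt_eq_setIntegral hf, enInt_eq_setIntegral (hf.mono_set inter_subset_left),
    ← EReal.coe_ennreal_toReal hJF, ← EReal.coe_ennreal_toReal hI, ← EReal.coe_add,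
    ← EReal.coe_add, EReal.coe_le_coe_iff, ← integral_inter_add_sdiff hB hf] at hE
  have hcI := setIntegral_ge_of_const_le_real (hF.diff hB) hvol hc (hf.mono_set sdiff_subset)
  rw [Measure.real] at hcI
  linarith

/-- Points of the ball of radius `‖x‖` that lie outside the ball of radius `2 ‖x‖` centered at
`-(1 + a) x` are close to `x`. -/
lemma norm_sub_sq_le_of_two_mul_le {E : Type*} [NormedAddCommGroup E] [InnerProductSpace ℝ E]
    {x p : E} {a : ℝ} (ha : 0 ≤ a) (ha1 : a ≤ 1) (hp : ‖p‖ ≤ ‖x‖)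
    (hpx : 2 * ‖x‖ ≤ ‖p + (1 + a) • x‖) :
    (1 - a) * ‖x‖ ≤ ‖p‖ ∧ ‖p - x‖ ^ 2 ≤ 4 * a * ‖x‖ ^ 2 := by
  have hx := norm_nonneg x
  have h1 : (2 - a) * ‖x‖ ≤ ‖p + x‖ := by
    have : ‖p + (1 + a) • x‖ ≤ ‖p + x‖ + a * ‖x‖ := by
      calc ‖p + (1 + a) • x‖ = ‖(p + x) + a • x‖ := by congr 1; module
        _ ≤ _ := (norm_add_le _ _).trans_eq (by rw [norm_smul, Real.norm_of_nonneg ha])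
    linarith
  refine ⟨by linarith [norm_add_le p x], ?_⟩
  have hpar := parallelogram_law_with_norm ℝ p x
  have h2 : ((2 - a) * ‖x‖) ^ 2 ≤ ‖p + x‖ ^ 2 := by gcongr; nlinarith
  have h3 : ‖p‖ ^ 2 ≤ ‖x‖ ^ 2 := by gcongr
  nlinarith [sq_nonneg (a * ‖x‖)]

/-- If a minimizer `F` is contained in the closed ball of radius `‖x‖` and charges every
neighborhood of `x`, then a larger ball touching at `x` has lower curvature at most `-f(x)`. -/
lemma kappaPlus_le_of_minimizer {N : ℕ} {J : Set (EuclideanSpace ℝ (Fin N)) → ℝ≥0∞}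
    (hJsub : ∀ A B : Set (EuclideanSpace ℝ (Fin N)), MeasurableSet A → MeasurableSet B →
      J (A ∪ B) + J (A ∩ B) ≤ J A + J B)
    (hJtrans : ∀ (A : Set (EuclideanSpace ℝ (Fin N))) (y : EuclideanSpace ℝ (Fin N)),
      J ((fun x => x + y) '' A) = J A)
    (hJball : ∀ (z : EuclideanSpace ℝ (Fin N)) (r : ℝ), 0 < r → J (Metric.ball z r) < ⊤)
    {R h : ℝ} (hh : 0 < h) {F : Set (EuclideanSpace ℝ (Fin N))} (hF : MeasurableSet F)
    (hJF : J F ≠ ⊤)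
    (hmin : ∀ G, MeasurableSet G →
      ene J (fun x => (‖x‖ - R) / h) F ≤ ene J (fun x => (‖x‖ - R) / h) G)
    {x : EuclideanSpace ℝ (Fin N)} (hx : 0 < ‖x‖) (hFx : F ⊆ Metric.closedBall 0 ‖x‖)
    (hpos : ∀ U ∈ nhds x, 0 < volume (U ∩ F)) :
    kappaPlus J x (Metric.ball (-x) (2 * ‖x‖)) ≤ (((R - ‖x‖) / h : ℝ) : EReal) := by
  set r := ‖x‖
  set a : ℕ → ℝ := fun n => 1 / ((n : ℝ) + 1) with ha_def
  have ha0 (n : ℕ) : 0 < a n := Nat.one_div_pos_of_nat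
  have ha1 (n : ℕ) : a n ≤ 1 := by
    rw [ha_def]; simp only
    rw [div_le_one (by positivity)]
    linarith [(Nat.cast_nonneg n : (0 : ℝ) ≤ n)]
  have ha : Tendsto a atTop (nhds 0) := tendsto_one_div_add_atTop_nhds_zero_nat
  set B := Metric.ball (-x) (2 * r)
  set C : ℕ → Set (EuclideanSpace ℝ (Fin N)) := fun n => Metric.ball (-((1 + a n) • x)) (2 * r)
  set T : ℕ → EuclideanSpace ℝ (Fin N) → EuclideanSpace ℝ (Fin N) := fun n p => p + a n • x
  have hTinj (n : ℕ) : Function.Injective (T n) := add_left_injective _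
  have hTvol (n : ℕ) (S : Set (EuclideanSpace ℝ (Fin N))) : volume (T n '' S) = volume S := by
    simp only [T, image_add_right, measure_preimage_add_right]
  have hTC (n : ℕ) : T n '' C n = B := by
    ext p
    simp only [T, image_add_right, mem_preimage, C, B, mem_ball_iff_norm]
    rw [show p + -(a n • x) - -((1 + a n) • x) = p - -x by module]
  have hCmeas (n : ℕ) : MeasurableSet (C n) := measurableSet_ball
  have hnear (n : ℕ) {p : EuclideanSpace ℝ (Fin N)} (hp : p ∈ F \ C n) :
      (1 - a n) * r ≤ ‖p‖ ∧ ‖p - x‖ ^ 2 ≤ 4 * a n * r ^ 2 := by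
    refine norm_sub_sq_le_of_two_mul_le (ha0 n).le (ha1 n) (by simpa using hFx hp.1) ?_
    simpa only [C, mem_ball_iff_norm, sub_neg_eq_add, not_lt] using hp.2
  set W : ℕ → Set (EuclideanSpace ℝ (Fin N)) := fun n => T n '' (F \ C n)
  have hWdiff (n : ℕ) : W n \ B = W n := by
    rw [← hTC n, ← image_sdiff (hTinj n), sdiff_sdiff, union_self]
  have hWunion (n : ℕ) : B ∪ W n = T n '' (F ∪ C n) := by
    rw [← hTC n, ← image_union, union_sdiff_self, union_comm]
  have hWmeas (n : ℕ) : MeasurableSet (W n) :=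
    (measurableEmbedding_addRight (a n • x)).measurableSet_image.2 (hF.diff (hCmeas n))
  have hFfin : volume F ≠ ⊤ :=
    ne_top_of_le_ne_top Metric.isBounded_closedBall.measure_lt_top.ne (measure_mono hFx)
  have hDfin (n : ℕ) : volume (F \ C n) ≠ ⊤ :=
    ne_top_of_le_ne_top hFfin (measure_mono sdiff_subset)
  have hDpos (n : ℕ) : 0 < volume (F \ C n) := by
    have hU : (Metric.closedBall (-((1 + a n) • x)) (2 * r))ᶜ ∈ nhds x := by
      refine Metric.isClosed_closedBall.isOpen_compl.mem_nhds ?_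
      rw [mem_compl_iff, mem_closedBall_iff_norm, not_le,
        show x - -((1 + a n) • x) = (2 + a n) • x by module, norm_smul,
        Real.norm_of_nonneg (by linarith [ha0 n])]
      nlinarith [ha0 n]
    refine (hpos _ hU).trans_le (measure_mono ?_)
    rintro p ⟨hpU, hpF⟩
    exact ⟨hpF, fun hpC => hpU (Metric.ball_subset_closedBall hpC)⟩
  have hint : IntegrableOn (fun x : EuclideanSpace ℝ (Fin N) => (‖x‖ - R) / h) F :=
    (ContinuousOn.integrableOn_compact (isCompact_closedBall 0 r)
      (by fun_prop)).mono_set hFx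
  have hquot (n : ℕ) : ((J (B ∪ W n) : EReal) - (J B : EReal)) *
      (((volume (W n \ B)).toReal)⁻¹ : ℝ) ≤ ((-(((1 - a n) * r - R) / h) : ℝ) : EReal) := by
    have hJC : J (C n) ≠ ⊤ := (hJball _ _ (by positivity)).ne
    obtain ⟨hfin, hle⟩ := toReal_union_sub_le_of_minimizer hJsub hF (hCmeas n) hJF hJC hint
      (hDfin n) hmin (c := ((1 - a n) * r - R) / h)
      (fun p hp => by have := (hnear n hp).1; gcongr)
    have hpos' := ENNReal.toReal_pos (hDpos n).ne' (hDfin n)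
    rw [hWdiff, hWunion, hJtrans, hTvol, ← hTC n, hJtrans, ← EReal.coe_ennreal_toReal hfin,
      ← EReal.coe_ennreal_toReal hJC, ← EReal.coe_sub, ← EReal.coe_mul, EReal.coe_le_coe_iff,
      ← div_eq_mul_inv, div_le_iff₀ hpos']
    exact hle
  have hlim : Tendsto (fun n => ((-(((1 - a n) * r - R) / h) : ℝ) : EReal)) atTop
      (nhds (((R - r) / h : ℝ) : EReal)) := by
    refine (continuous_coe_real_ereal.tendsto _).comp ?_
    have : Tendsto (fun n => -(((1 - a n) * r - R) / h)) atTop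
        (nhds (-(((1 - 0) * r - R) / h))) :=
      (((((ha.const_sub 1).mul_const r).sub_const R).div_const h)).neg
    convert this using 2
    ring
  have hshrink : ∀ ε > (0 : ℝ), ∀ᶠ n in atTop, W n ⊆ Metric.closedBall x ε := by
    intro ε hε
    have hb : Tendsto (fun n => √(4 * a n * r ^ 2) + a n * r) atTop (nhds 0) := by
      have : Tendsto (fun n => √(4 * a n * r ^ 2) + a n * r) atTop
          (nhds (√(4 * 0 * r ^ 2) + 0 * r)) :=
        ((((ha.const_mul 4).mul_const (r ^ 2)).sqrt).add (ha.mul_const r))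
      simpa using this
    filter_upwards [hb.eventually_le_const hε] with n hn
    rintro _ ⟨p, hp, rfl⟩
    rw [mem_closedBall_iff_norm]
    calc ‖p + a n • x - x‖ = ‖(p - x) + a n • x‖ := by congr 1; module
      _ ≤ ‖p - x‖ + ‖a n • x‖ := norm_add_le _ _
      _ ≤ √(4 * a n * r ^ 2) + a n * r := by
        rw [norm_smul, Real.norm_of_nonneg (ha0 n).le]
        gcongr
        exact Real.le_sqrt_of_sq_le (hnear n hp).2
      _ ≤ ε := hn
  calc kappaPlus J x B ≤ _ :=
        sInf_le ⟨W, hWmeas, fun n => by rw [hWdiff, hTvol]; exact hDpos n, hshrink, rfl⟩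
    _ ≤ liminf (fun n => ((-(((1 - a n) * r - R) / h) : ℝ) : EReal)) atTop :=
        liminf_le_liminf (Eventually.of_forall hquot)
    _ = _ := hlim.liminf_eq

/-- If every ball of radius `≤ 2M` has lower curvature `≥ m` at each of
its boundary points, then any minimizer `F` of `J(G) + (1/h)∫_G (|x| − R) dx` that is
(up to a null set) contained in `B_M` is in fact contained, up to a null set, in the
closed ball of radius `R − hm`, provided `R − hm > 0`. -/
theorem stmt9 (N : ℕ) (hN : 1 ≤ N)
    (J : Set (EuclideanSpace ℝ (Fin N)) → ℝ≥0∞)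
    (hJsub : ∀ A B : Set (EuclideanSpace ℝ (Fin N)), MeasurableSet A → MeasurableSet B →
      J (A ∪ B) + J (A ∩ B) ≤ J A + J B)
    (hJtrans : ∀ (A : Set (EuclideanSpace ℝ (Fin N))) (y : EuclideanSpace ℝ (Fin N)),
      J ((fun x => x + y) '' A) = J A)
    (hJnull : ∀ A B : Set (EuclideanSpace ℝ (Fin N)), MeasurableSet A → MeasurableSet B →
      volume (symmDiff A B) = 0 → J A = J B)
    (hJempty : J ∅ = 0)
    (hJball : ∀ (z : EuclideanSpace ℝ (Fin N)) (r : ℝ), 0 < r → J (Metric.ball z r) < ⊤)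
    (R h M : ℝ) (hR : 0 < R) (hh : 0 < h) (hRM : R ≤ M)
    (F : Set (EuclideanSpace ℝ (Fin N))) (hFmeas : MeasurableSet F)
    (hFmin : ∀ G, MeasurableSet G →
      ene J (fun x => (‖x‖ - R) / h) F ≤ ene J (fun x => (‖x‖ - R) / h) G)
    (hFM : volume (F \ Metric.ball (0 : EuclideanSpace ℝ (Fin N)) M) = 0)
    (m : ℝ)
    (hm : ∀ (z : EuclideanSpace ℝ (Fin N)) (ρ : ℝ), 0 < ρ → ρ ≤ 2 * M →
      ∀ x : EuclideanSpace ℝ (Fin N), dist x z = ρ →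
        (m : EReal) ≤ kappaPlus J x (Metric.ball z ρ))
    (hRhm : 0 < R - h * m) :
    volume (F \ Metric.closedBall (0 : EuclideanSpace ℝ (Fin N)) (R - h * m)) = 0 := by
  set f : EuclideanSpace ℝ (Fin N) → ℝ := fun x => (‖x‖ - R) / h
  set K := (volume.restrict F).support
  have hKnull : volume (F \ K) = 0 := by
    have := Measure.measure_compl_support (μ := volume.restrict F)
    rwa [Measure.restrict_apply Measure.isOpen_compl_support.measurableSet, inter_comm] at this
  rcases K.eq_empty_or_nonempty with hK | hK
  · rw [hK, sdiff_empty] at hKnull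
    exact measure_mono_null sdiff_subset hKnull
  have hKM : K ⊆ Metric.closedBall 0 M := by
    refine Measure.support_subset_of_isClosed Metric.isClosed_closedBall ?_
    rw [mem_ae_iff, Measure.restrict_apply measurableSet_closedBall.compl]
    refine measure_mono_null ?_ hFM
    rintro p ⟨hpM, hpF⟩
    exact ⟨hpF, fun hp => hpM (Metric.ball_subset_closedBall hp)⟩
  have hKcomp : IsCompact K :=
    (isCompact_closedBall 0 M).of_isClosed_subset Measure.isClosed_support hKM
  obtain ⟨x, hxK, hxmax⟩ := hKcomp.exists_isMaxOn hK continuous_norm.continuousOn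
  have hFx : volume (F \ Metric.closedBall 0 ‖x‖) = 0 :=
    measure_mono_null (sdiff_subset_sdiff_right fun p hp => by simpa using hxmax hp) hKnull
  rcases le_or_gt ‖x‖ (R - h * m) with hle | hgt
  · exact measure_mono_null
      (sdiff_subset_sdiff_right (Metric.closedBall_subset_closedBall hle)) hFx
  exfalso
  have hx0 : 0 < ‖x‖ := hRhm.trans hgt
  have hxM : ‖x‖ ≤ M := by simpa using hKM hxK
  set F' := F ∩ Metric.closedBall 0 ‖x‖
  have hF'meas : MeasurableSet F' := hFmeas.inter measurableSet_closedBall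
  have hF'ae : F' =ᵐ[volume] F := by
    refine inter_subset_left.eventuallyLE.antisymm ?_
    rw [ae_le_set, sdiff_self_inter]
    exact hFx
  have hmin' : ∀ G, MeasurableSet G → ene J f F' ≤ ene J f G := by
    rw [ene_congr (hJnull _ _ hF'meas hFmeas (measure_symmDiff_eq_zero_iff.2 hF'ae)) hF'ae]
    exact hFmin
  have hJF' : J F' ≠ ⊤ := by
    intro htop
    have hint : IntegrableOn f F' :=
      (ContinuousOn.integrableOn_compact (isCompact_closedBall 0 ‖x‖)
        (by fun_prop)).mono_set inter_subset_right
    have := hmin' ∅ MeasurableSet.empty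
    rw [ene, ene, enInt_eq_setIntegral hint, htop, hJempty] at this
    simp [enInt] at this
  have hpos : ∀ U ∈ nhds x, 0 < volume (U ∩ F') := by
    intro U hU
    have := (Measure.mem_support_iff_forall x).1 hxK U hU
    rw [Measure.restrict_apply' hFmeas] at this
    rwa [measure_congr ((ae_eq_refl U).inter hF'ae)]
  have hκ := (hm (-x) (2 * ‖x‖) (by positivity) (by linarith) x
    (by rw [dist_eq_norm, sub_neg_eq_add, ← two_smul ℝ x, norm_smul]; simp)).trans
    (kappaPlus_le_of_minimizer hJsub hJtrans hJball hh hF'meas hJF' hmin' hx0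
      inter_subset_right hpos)
  rw [EReal.coe_le_coe_iff, le_div_iff₀ hh] at hκ
  linarith
end

section
/- Let N ≥ 1 and let K : ℝ^N → [0, +∞] be measurable. For every Lebesgue-measurable set E ⊆ ℝ^N define the interaction perimeter J_K(E) := ∫_E ∫_{ℝ^N \ E} K(x − y) dy dx ∈ [0, +∞]. Then J_K is submodular: J_K(E ∪ F) + J_K(E ∩ F) ≤ J_K(E) + J_K(F) for all Lebesgue-measurable sets E, F ⊆ ℝ^N. -/
open MeasureTheory Filter Set
open scoped ENNReal

/-- The two-body interaction perimeter `J_K(E) = ∫_E ∫_{ℝ^N \ E} K(x − y) dy dx`. -/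
noncomputable def JK {N : ℕ} (K : EuclideanSpace ℝ (Fin N) → ℝ≥0∞)
    (E : Set (EuclideanSpace ℝ (Fin N))) : ℝ≥0∞ :=
  ∫⁻ x in E, (∫⁻ y in Eᶜ, K (x - y) ∂volume) ∂volume

theorem measurable_setLIntegral_sub {N : ℕ} {K : EuclideanSpace ℝ (Fin N) → ℝ≥0∞}
    (hK : Measurable K) (A : Set (EuclideanSpace ℝ (Fin N))) :
    Measurable fun x => ∫⁻ y in A, K (x - y) :=
  (hK.comp (measurable_fst.sub measurable_snd)).lintegral_prod_right'

/-- The sum of two interaction perimeters as a single integral over the whole space. -/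
theorem JK_add_JK {N : ℕ} {K : EuclideanSpace ℝ (Fin N) → ℝ≥0∞} (hK : Measurable K)
    {A B : Set (EuclideanSpace ℝ (Fin N))} (hA : MeasurableSet A) (hB : MeasurableSet B) :
    JK K A + JK K B = ∫⁻ x, (A.indicator (fun x => ∫⁻ y in Aᶜ, K (x - y)) x +
      B.indicator (fun x => ∫⁻ y in Bᶜ, K (x - y)) x) := by
  rw [lintegral_add_left ((measurable_setLIntegral_sub hK _).indicator hA),
    lintegral_indicator hA, lintegral_indicator hB, JK, JK]

theorem setLIntegral_compl_union_add_compl_inter {α : Type*} [MeasurableSpace α] (μ : Measure α)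
    (f : α → ℝ≥0∞) {E F : Set α} (hE : MeasurableSet E) (hF : MeasurableSet F) :
    ∫⁻ y in (E ∪ F)ᶜ, f y ∂μ + ∫⁻ y in (E ∩ F)ᶜ, f y ∂μ =
      ∫⁻ y in Eᶜ, f y ∂μ + ∫⁻ y in Fᶜ, f y ∂μ := by
  rw [← withDensity_apply f (hE.union hF).compl, ← withDensity_apply f (hE.inter hF).compl,
    ← withDensity_apply f hE.compl, ← withDensity_apply f hF.compl, compl_union, compl_inter,
    add_comm, measure_union_add_inter _ hF.compl]

/-- The interaction perimeter `J_K` associated with a nonnegative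
measurable kernel `K` is submodular. -/
theorem stmt13 (N : ℕ) (hN : 1 ≤ N)
    (K : EuclideanSpace ℝ (Fin N) → ℝ≥0∞) (hK : Measurable K)
    (E F : Set (EuclideanSpace ℝ (Fin N)))
    (hE : MeasurableSet E) (hF : MeasurableSet F) :
    JK K (E ∪ F) + JK K (E ∩ F) ≤ JK K E + JK K F := by
  rw [JK_add_JK hK (hE.union hF) (hE.inter hF), JK_add_JK hK hE hF]
  refine lintegral_mono fun x => ?_
  by_cases hxE : x ∈ E <;> by_cases hxF : x ∈ F <;>
    simp only [indicator, mem_union, mem_inter_iff, hxE, hxF, or_true, true_or, or_self, and_self,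
      and_true, true_and, if_true, if_false, add_zero, zero_add, le_refl]
  · exact (setLIntegral_compl_union_add_compl_inter _ _ hE hF).le
  · exact lintegral_mono_set (compl_subset_compl.2 subset_union_left)
  · exact lintegral_mono_set (compl_subset_compl.2 subset_union_right)
end

section
/- Let X be a set and let C be a function from the subsets of X to [0, +∞] which is monotone (C(A) ≤ C(B) whenever A ⊆ B) and submodular (C(A ∪ B) + C(A ∩ B) ≤ C(A) + C(B) for all A, B ⊆ X), and which satisfies the dichotomy: for every A ⊆ X, C(A) = +∞ or C(X \ A) = +∞. Then the set function J defined by J(A) := min{C(A), C(X \ A)} is submodular: J(A ∪ B) + J(A ∩ B) ≤ J(A) + J(B) for all A, B ⊆ X. -/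
open Set
open scoped ENNReal

/-- If `C` is a monotone submodular set function on a set `X` with
values in `[0, +∞]` such that for every `A`, `C(A) = +∞` or `C(X \ A) = +∞`, then
`J(A) := min{C(A), C(X \ A)}` is submodular. -/
theorem stmt14 (X : Type*) (C : Set X → ℝ≥0∞)
    (hmono : ∀ A B : Set X, A ⊆ B → C A ≤ C B)
    (hsub : ∀ A B : Set X, C (A ∪ B) + C (A ∩ B) ≤ C A + C B)
    (hdich : ∀ A : Set X, C A = ⊤ ∨ C Aᶜ = ⊤) :
    ∀ A B : Set X,
      min (C (A ∪ B)) (C (A ∪ B)ᶜ) + min (C (A ∩ B)) (C (A ∩ B)ᶜ) ≤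
        min (C A) (C Aᶜ) + min (C B) (C Bᶜ) := by
  intro A B
  have hAB := hsub A B
  have hcompl := hsub Aᶜ Bᶜ
  rw [← compl_inter, ← compl_union, add_comm] at hcompl
  rcases min_choice (C A) (C Aᶜ) with hA | hA <;>
    rcases min_choice (C B) (C Bᶜ) with hB | hB <;> rw [hA, hB]
  · exact (add_le_add (min_le_left _ _) (min_le_left _ _)).trans hAB
  · rw [add_comm (C A)]
    exact add_le_add
      ((min_le_right _ _).trans (hmono _ _ (compl_subset_compl.2 subset_union_right)))
      ((min_le_left _ _).trans (hmono _ _ inter_subset_left))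
  · exact add_le_add
      ((min_le_right _ _).trans (hmono _ _ (compl_subset_compl.2 subset_union_left)))
      ((min_le_left _ _).trans (hmono _ _ inter_subset_right))
  · exact (add_le_add (min_le_right _ _) (min_le_right _ _)).trans hcompl
end

section
/- Let N ≥ 1 and let J be a set function on the Lebesgue-measurable subsets of ℝ^N with values in [0, +∞] which is submodular, translation invariant, and insensitive to null sets. Let E ⊆ F ⊆ ℝ^N be Lebesgue-measurable sets with J(E) < +∞ and J(F) < +∞, with E compact, and let x ∈ ∂E ∩ ∂F be such that E \ {x} is contained in the interior of F. Suppose there is a unit vector ν ∈ ℝ^N such that |(E + εν) \ F| > 0 for all sufficiently small ε > 0. Then κ⁺(x, F) ≤ κ⁻(x, E). In particular, if the curvatures of E and F at x exist, i.e. κ⁺(x, E) = κ⁻(x, E) =: κ(x, E) ∈ ℝ and κ⁺(x, F) = κ⁻(x, F) =: κ(x, F) ∈ ℝ, then κ(x, F) ≤ κ(x, E). -/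
open MeasureTheory Filter Set
open scoped ENNReal

/-- The upper curvature `κ⁻(x, A)` relative to `J` (convention: `sSup ∅ = ⊥`). -/
noncomputable def kappaMinus {N : ℕ} (J : Set (EuclideanSpace ℝ (Fin N)) → ℝ≥0∞)
    (x : EuclideanSpace ℝ (Fin N)) (A : Set (EuclideanSpace ℝ (Fin N))) : EReal :=
  sSup { v : EReal | ∃ W : ℕ → Set (EuclideanSpace ℝ (Fin N)),
    (∀ n, MeasurableSet (W n)) ∧ (∀ n, 0 < volume (W n ∩ A)) ∧
    (∀ ε > (0:ℝ), ∀ᶠ n in atTop, W n ⊆ Metric.closedBall x ε) ∧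
    v = limsup (fun n =>
      ((J A : EReal) - (J (A \ W n) : EReal)) * (((volume (W n ∩ A)).toReal)⁻¹ : ℝ))
      atTop }

/-- Adding to `F` the part of the translate `E + c` outside `F` costs at most as much `J` as is
gained by removing from `E` the corresponding part. -/
theorem translate_increment_le {G : Type*} [AddGroup G] [MeasurableSpace G] [MeasurableAdd G]
    {J : Set G → ℝ≥0∞}
    (hJsub : ∀ A B : Set G, MeasurableSet A → MeasurableSet B →
      J (A ∪ B) + J (A ∩ B) ≤ J A + J B)
    (hJtrans : ∀ (A : Set G) (y : G), J ((fun x => x + y) '' A) = J A)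
    {E F : Set G} (hE : MeasurableSet E) (hF : MeasurableSet F)
    (hJE : J E < ⊤) (hJF : J F < ⊤) (c : G) :
    (J (F ∪ ((fun y => y + c) '' E) \ F) : EReal) - (J F : EReal) ≤
      (J E : EReal) - (J (E \ (E \ (fun y => y + c) ⁻¹' F)) : EReal) := by
  have hEc : MeasurableSet ((fun y => y + c) '' E) :=
    (MeasurableEquiv.addRight c).measurableSet_image.2 hE
  have key := hJsub F _ hF hEc
  rw [hJtrans, inter_comm, ← image_inter_preimage, hJtrans] at key
  rw [union_sdiff_self, sdiff_sdiff_right_self]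
  have hfin : J F + J E < ⊤ := ENNReal.add_lt_top.2 ⟨hJF, hJE⟩
  have h₁ : J (F ∪ (fun y => y + c) '' E) ≠ ⊤ := (le_self_add.trans key |>.trans_lt hfin).ne
  have h₂ : J (E ∩ (fun y => y + c) ⁻¹' F) ≠ ⊤ := (le_add_self.trans key |>.trans_lt hfin).ne
  generalize J (F ∪ (fun y => y + c) '' E) = p at *
  generalize J (E ∩ (fun y => y + c) ⁻¹' F) = q at *
  generalize J E = e at *
  generalize J F = f at *
  lift p to NNReal using h₁
  lift q to NNReal using h₂
  lift e to NNReal using hJE.ne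
  lift f to NNReal using hJF.ne
  have key' : (p : ℝ) + q ≤ f + e := by exact_mod_cast key
  have h : (p : ℝ) - f ≤ e - q := by linarith
  simp only [EReal.coe_nnreal_eq_coe_real]
  exact_mod_cast EReal.coe_le_coe_iff.2 h

/-- If `E` is compact and touches the complement of the interior of `F` only at `x`, then small
translates of `E` leave `F` only near `x`. -/
theorem exists_translate_mem_ball {V : Type*} [NormedAddCommGroup V] {E F : Set V} {x : V}
    (hE : IsCompact E) (hint : E \ {x} ⊆ interior F) {r : ℝ} (hr : 0 < r) :
    ∃ δ > 0, ∀ c : V, ‖c‖ < δ → ∀ y ∈ E, y + c ∉ F → y ∈ Metric.ball x r := by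
  have hK : E \ Metric.ball x r ⊆ interior F := fun y hy =>
    hint ⟨hy.1, fun h => hy.2 (by rw [mem_singleton_iff.1 h]; exact Metric.mem_ball_self hr)⟩
  obtain ⟨δ, hδ, hsub⟩ :=
    (hE.diff Metric.isOpen_ball).exists_thickening_subset_open isOpen_interior hK
  refine ⟨δ, hδ, fun c hc y hy hyF => ?_⟩
  by_contra hyr
  exact hyF (interior_subset (hsub (Metric.mem_thickening_iff.2 ⟨y, ⟨hy, hyr⟩, by simpa using hc⟩)))

/-- **monotonicity of the curvature.** Let `J` be submodular, translation
invariant and null-insensitive, let `E ⊆ F` with finite perimeter values, `E` compact,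
`x ∈ ∂E ∩ ∂F` with `E \ {x}` inside the interior of `F`, and suppose that translating `E`
slightly in the direction of a unit vector `ν` pushes a positive-measure part of `E`
outside `F`.  Then `κ⁺(x, F) ≤ κ⁻(x, E)`; in particular, if the curvatures of `E` and `F`
at `x` exist (as real numbers), then `κ(x, F) ≤ κ(x, E)`. -/
theorem stmt15 (N : ℕ) (hN : 1 ≤ N)
    (J : Set (EuclideanSpace ℝ (Fin N)) → ℝ≥0∞)
    (hJsub : ∀ A B : Set (EuclideanSpace ℝ (Fin N)), MeasurableSet A → MeasurableSet B →
      J (A ∪ B) + J (A ∩ B) ≤ J A + J B)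
    (hJtrans : ∀ (A : Set (EuclideanSpace ℝ (Fin N))) (y : EuclideanSpace ℝ (Fin N)),
      J ((fun x => x + y) '' A) = J A)
    (hJnull : ∀ A B : Set (EuclideanSpace ℝ (Fin N)), MeasurableSet A → MeasurableSet B →
      volume (symmDiff A B) = 0 → J A = J B)
    (E F : Set (EuclideanSpace ℝ (Fin N)))
    (hEmeas : MeasurableSet E) (hFmeas : MeasurableSet F)
    (hEF : E ⊆ F) (hJE : J E < ⊤) (hJF : J F < ⊤)
    (hEcpt : IsCompact E)
    (x : EuclideanSpace ℝ (Fin N)) (hxE : x ∈ frontier E) (hxF : x ∈ frontier F)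
    (hint : E \ {x} ⊆ interior F)
    (ν : EuclideanSpace ℝ (Fin N)) (hν : ‖ν‖ = 1)
    (hpush : ∃ ε₀ > (0:ℝ), ∀ ε : ℝ, 0 < ε → ε < ε₀ →
      0 < volume (((fun y => y + ε • ν) '' E) \ F)) :
    kappaPlus J x F ≤ kappaMinus J x E ∧
    (∀ a b : ℝ, kappaPlus J x E = (a : EReal) → kappaMinus J x E = (a : EReal) →
      kappaPlus J x F = (b : EReal) → kappaMinus J x F = (b : EReal) → b ≤ a) := by
  suffices h : kappaPlus J x F ≤ kappaMinus J x E by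
    refine ⟨h, fun a b _ hEa hFb _ => ?_⟩
    rw [hEa, hFb] at h
    exact_mod_cast h
  obtain ⟨ε₀, hε₀, hpush⟩ := hpush
  obtain ⟨u, -, hu, hu0⟩ := exists_seq_strictAnti_tendsto' hε₀
  have hnorm : ∀ n, ‖u n • ν‖ = u n := fun n => by
    rw [norm_smul, hν, mul_one, Real.norm_of_nonneg (hu n).1.le]
  let T (n : ℕ) (y : EuclideanSpace ℝ (Fin N)) := y + u n • ν
  let W (n : ℕ) := (T n '' E) \ F
  let V (n : ℕ) := E \ T n ⁻¹' F
  have hTmeas : ∀ n, Measurable (T n) := fun n => measurable_id.add_const _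
  have hWmeas : ∀ n, MeasurableSet (W n) := fun n =>
    ((MeasurableEquiv.addRight (u n • ν)).measurableSet_image.2 hEmeas).diff hFmeas
  have hVmeas : ∀ n, MeasurableSet (V n) := fun n => hEmeas.diff (hTmeas n hFmeas)
  have hVW : ∀ n, volume (V n) = volume (W n) := fun n => by
    have h : T n ⁻¹' W n = V n := by
      simp only [W, V, preimage_sdiff, preimage_image_eq _ (add_left_injective (u n • ν)), T]
    rw [← h]
    exact measure_preimage_add_right volume (u n • ν) (W n)
  have hWF : ∀ n, W n \ F = W n := fun n => by simp [W]
  have hVE : ∀ n, V n ∩ E = V n := fun n => inter_eq_left.2 sdiff_subset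
  have hWpos : ∀ n, 0 < volume (W n) := fun n => hpush (u n) (hu n).1 (hu n).2
  have hVsmall : ∀ r > (0 : ℝ), ∀ᶠ n in atTop, V n ⊆ Metric.ball x r := fun r hr => by
    obtain ⟨δ, hδ, hsub⟩ := exists_translate_mem_ball hEcpt hint hr
    filter_upwards [hu0.eventually_lt_const hδ] with n hn y hy
    exact hsub _ ((hnorm n).trans_lt hn) y hy.1 hy.2
  have hWsmall : ∀ r > (0 : ℝ), ∀ᶠ n in atTop, W n ⊆ Metric.closedBall x r := fun r hr => by
    filter_upwards [hVsmall _ (half_pos hr), hu0.eventually_lt_const (half_pos hr)] with n hV hn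
    rintro _ ⟨⟨y, hy, rfl⟩, hyF⟩
    have h₁ := Metric.mem_ball.1 (hV ⟨hy, hyF⟩)
    have h₂ : dist (T n y) y = u n := by simp [T, hnorm]
    have h₃ := dist_triangle (T n y) y x
    exact Metric.mem_closedBall.2 (by linarith)
  calc kappaPlus J x F
      ≤ liminf (fun n => ((J (F ∪ W n) : EReal) - (J F : EReal)) *
          (((volume (W n \ F)).toReal)⁻¹ : ℝ)) atTop :=
        sInf_le ⟨W, hWmeas, fun n => by rw [hWF]; exact hWpos n, hWsmall, rfl⟩
    _ ≤ liminf (fun n => ((J E : EReal) - (J (E \ V n) : EReal)) *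
          (((volume (V n ∩ E)).toReal)⁻¹ : ℝ)) atTop := by
        refine liminf_le_liminf (Eventually.of_forall fun n => ?_)
        simp only [hWF, hVE, hVW]
        exact mul_le_mul_of_nonneg_right
          (translate_increment_le hJsub hJtrans hEmeas hFmeas hJE hJF (u n • ν))
          (EReal.coe_nonneg.2 (inv_nonneg.2 ENNReal.toReal_nonneg))
    _ ≤ limsup (fun n => ((J E : EReal) - (J (E \ V n) : EReal)) *
          (((volume (V n ∩ E)).toReal)⁻¹ : ℝ)) atTop := liminf_le_limsup
    _ ≤ kappaMinus J x E :=
        le_sSup ⟨V, hVmeas, fun n => by rw [hVE, hVW]; exact hWpos n,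
          fun r hr => (hVsmall r hr).mono fun n h => h.trans Metric.ball_subset_closedBall, rfl⟩
end
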